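/- arXiv:0808.1395 — 6 statements merged into one kernel-verified Lean document; each statement's English description precedes it below -/
import Mathlib

section
/- Stiefel's theorem on division algebras: if ℝ^n carries a structure of a division algebra, i.e. a bilinear map μ : ℝ^n × ℝ^n → ℝ^n without zero divisors (μ(x,y) = 0 implies x = 0 or y = 0), then n is a power of 2. -/
open Finset

/-! ### Commuting operators on odd-dimensional real spaces -/

theorem Polynomial.exists_isRoot_of_odd_natDegree_real {p : Polynomial ℝ} (hp : p.Monic)
    (hodd : Odd p.natDegree) : ∃ x, p.IsRoot x := by
  have hpos : 0 < p.degree := natDegree_pos_iff_degree_pos.mp hodd.pos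
  have htop := p.tendsto_atTop_of_leadingCoeff_nonneg hpos (by simp [hp.leadingCoeff])
  have hbot : Filter.Tendsto (fun x => (-p.comp (-X)).eval x) Filter.atTop Filter.atTop := by
    apply tendsto_atTop_of_leadingCoeff_nonneg
    · rw [← natDegree_pos_iff_degree_pos]
      simpa [natDegree_comp] using hodd.pos
    · rw [leadingCoeff_neg, leadingCoeff_comp (by simp)]
      simp [hp.leadingCoeff, hodd.neg_one_pow]
  obtain ⟨a, ha⟩ := (htop.eventually_ge_atTop 0).exists
  obtain ⟨b, hb⟩ := (hbot.eventually_ge_atTop 0).exists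
  have hb' : p.eval (-b) ≤ 0 := by simpa [eval_comp] using hb
  exact mem_range_of_exists_le_of_exists_ge p.continuous ⟨_, hb'⟩ ⟨a, ha⟩

theorem Module.End.exists_hasEigenvalue_of_odd_finrank {V : Type*} [AddCommGroup V] [Module ℝ V]
    [FiniteDimensional ℝ V] (hV : Odd (Module.finrank ℝ V)) (f : Module.End ℝ V) :
    ∃ c, f.HasEigenvalue c := by
  obtain ⟨c, hc⟩ := Polynomial.exists_isRoot_of_odd_natDegree_real f.charpoly_monic
    (by rwa [LinearMap.charpoly_natDegree])
  exact ⟨c, Module.End.hasEigenvalue_iff_isRoot_charpoly f c |>.mpr hc⟩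

/-- Pairwise commuting operators on a real space of odd dimension have a common eigenvector. -/
theorem Module.End.exists_common_eigenvector_of_odd_finrank {J V : Type*} [AddCommGroup V]
    [Module ℝ V] [FiniteDimensional ℝ V] (hV : Odd (Module.finrank ℝ V))
    (f : J → Module.End ℝ V) (hf : ∀ i j v, f i (f j v) = f j (f i v)) :
    ∃ v ≠ 0, ∃ c : J → ℝ, ∀ j, f j v = c j • v := by
  by_cases hscalar : ∀ j, ∃ c : ℝ, ∀ v, f j v = c • v
  · choose c hc using hscalar
    have : Nontrivial V := Module.nontrivial_of_finrank_pos hV.pos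
    obtain ⟨v, hv⟩ := exists_ne (0 : V)
    exact ⟨v, hv, c, fun j => hc j v⟩
  push Not at hscalar
  obtain ⟨j, hj⟩ := hscalar
  obtain ⟨c, hc⟩ := exists_hasEigenvalue_of_odd_finrank hV (f j)
  let g : V →ₗ[ℝ] V := f j - c • LinearMap.id
  have hg : ∀ v, g v = f j v - c • v := fun v => rfl
  have descend : ∀ W : Submodule ℝ V, Module.finrank ℝ W < Module.finrank ℝ V →
      Odd (Module.finrank ℝ W) → (∀ i, ∀ v ∈ W, f i v ∈ W) →
      ∃ v ≠ 0, ∃ c : J → ℝ, ∀ j, f j v = c j • v := by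
    intro W hlt hodd hW
    obtain ⟨v, hv, d, hd⟩ := exists_common_eigenvector_of_odd_finrank hodd
      (fun i => (f i).restrict (hW i)) (fun i i' v => Subtype.ext (hf i i' v))
    exact ⟨v, by simpa using hv, d, fun i => congrArg Subtype.val (hd i)⟩
  have hsum := g.finrank_range_add_finrank_ker
  have hker_pos : 0 < Module.finrank ℝ (LinearMap.ker g) := by
    obtain ⟨v, hv⟩ := hc.exists_hasEigenvector
    have : Nontrivial (LinearMap.ker g) :=
      ⟨⟨v, by simp [hg, hv.apply_eq_smul]⟩, 0, by simpa [Subtype.ext_iff] using hv.2⟩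
    exact Module.finrank_pos
  have hrange_pos : 0 < Module.finrank ℝ (LinearMap.range g) := by
    obtain ⟨v, hv⟩ := hj c
    have : Nontrivial (LinearMap.range g) :=
      ⟨⟨g v, v, rfl⟩, 0, by simpa [Subtype.ext_iff, hg, sub_eq_zero] using hv⟩
    exact Module.finrank_pos
  rcases Nat.even_or_odd (Module.finrank ℝ (LinearMap.ker g)) with he | ho
  · refine descend (LinearMap.range g) (by omega) (by grind) ?_
    rintro i _ ⟨v, rfl⟩
    exact ⟨f i v, by simp [hg, hf i j]⟩
  · refine descend (LinearMap.ker g) (by omega) ho ?_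
    intro i v hv
    rw [LinearMap.mem_ker, hg, sub_eq_zero] at hv
    simp [hg, ← hf i j, hv]
termination_by Module.finrank ℝ V

/-! ### Injectivity is generic along polynomial families of linear maps -/

theorem LinearMap.eventually_injective_quadratic {V W : Type*} [AddCommGroup V] [Module ℝ V]
    [FiniteDimensional ℝ V] [AddCommGroup W] [Module ℝ W] (f g h : V →ₗ[ℝ] W)
    (hf : Function.Injective f) :
    ∀ᶠ t : ℝ in Filter.atTop, Function.Injective (f + t • g + t ^ 2 • h) := by
  classical
  obtain ⟨r, hr⟩ := f.exists_leftInverse_of_injective (LinearMap.ker_eq_bot.mpr hf)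
  let b := Module.finBasis ℝ V
  let G := LinearMap.toMatrix b b (r ∘ₗ g)
  let H := LinearMap.toMatrix b b (r ∘ₗ h)
  let p : Polynomial ℝ := Matrix.det (1 + (Polynomial.X : Polynomial ℝ) • G.map Polynomial.C
    + (Polynomial.X ^ 2 : Polynomial ℝ) • H.map Polynomial.C)
  have hp : ∀ t : ℝ, p.eval t = Matrix.det (1 + t • G + t ^ 2 • H) := by
    intro t
    rw [← Polynomial.coe_evalRingHom, RingHom.map_det]
    congr 1
    ext i j
    by_cases hij : i = j <;> simp [hij] <;> ring
  have hp0 : p ≠ 0 := by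
    intro h0
    have := hp 0
    simp [h0] at this
  filter_upwards [Polynomial.eventually_atTop_not_isRoot p hp0] with t ht
  have hdet : LinearMap.det (r ∘ₗ (f + t • g + t ^ 2 • h)) ≠ 0 := by
    rw [← LinearMap.det_toMatrix b, LinearMap.comp_add, LinearMap.comp_add, hr,
      LinearMap.comp_smul, LinearMap.comp_smul]
    simpa [LinearMap.toMatrix_id] using (hp t) ▸ ht
  have hinj := LinearMap.ker_eq_bot.mp
    (LinearMap.ker_eq_bot_of_injective (LinearEquiv.ofIsUnitDet
      (f := r ∘ₗ (f + t • g + t ^ 2 • h)) (v := b) (v' := b)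
      (by rw [LinearMap.det_toMatrix]; exact hdet.isUnit)).injective)
  exact Function.Injective.of_comp (f := r) hinj

/-! ### Symmetric tensors and contractions -/

/-- Contraction of a symmetric tensor of order `k + 1` with a covector. -/
def symContract {ι : Type*} [Fintype ι] {k : ℕ} (c : ι → ℝ) :
    (Sym ι (k + 1) → ℝ) →ₗ[ℝ] (Sym ι k → ℝ) where
  toFun z s := ∑ b, c b * z (b ::ₛ s)
  map_add' z w := by ext s; simp [mul_add, sum_add_distrib]
  map_smul' t z := by ext s; simp [mul_sum, mul_left_comm]

section

variable {ι : Type*} [Fintype ι] {k : ℕ}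

theorem symContract_apply (c : ι → ℝ) (z : Sym ι (k + 1) → ℝ) (s : Sym ι k) :
    symContract c z s = ∑ b, c b * z (b ::ₛ s) := rfl

theorem symContract_comm (c d : ι → ℝ) (z : Sym ι (k + 2) → ℝ) :
    symContract c (symContract d z) = symContract d (symContract c z) := by
  ext s
  simp only [symContract_apply, mul_sum]
  rw [sum_comm]
  refine sum_congr rfl fun a _ => sum_congr rfl fun b _ => ?_
  rw [Sym.cons_swap, mul_left_comm]

theorem symContract_add (c d : ι → ℝ) (z : Sym ι (k + 1) → ℝ) :
    symContract (c + d) z = symContract c z + symContract d z := by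
  ext s
  simp [symContract_apply, add_mul, sum_add_distrib]

theorem symContract_smul (t : ℝ) (c : ι → ℝ) (z : Sym ι (k + 1) → ℝ) :
    symContract (t • c) z = t • symContract c z := by
  ext s
  simp [symContract_apply, mul_sum, mul_assoc]

variable {J κ : Type*} [Fintype J]

/-- The operator sending a family `z` of symmetric tensors to `∑ j, B j l ⌟ z j`. -/
def contractSum (B : J → κ → ι → ℝ) :
    (J → Sym ι (k + 1) → ℝ) →ₗ[ℝ] (κ → Sym ι k → ℝ) where
  toFun z l := ∑ j, symContract (B j l) (z j)
  map_add' z w := by ext l : 1; simp [sum_add_distrib]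
  map_smul' t z := by ext l : 1; simp [smul_sum]

theorem contractSum_apply (B : J → κ → ι → ℝ) (z : J → Sym ι (k + 1) → ℝ) (l : κ) :
    contractSum B z l = ∑ j, symContract (B j l) (z j) := rfl

/-- The double contraction `∑ i j, B i l ⌟ C j l' ⌟ w i j`. -/
def contractSum₂ (B C : J → κ → ι → ℝ) :
    (J → J → Sym ι (k + 2) → ℝ) →ₗ[ℝ] (κ → κ → Sym ι k → ℝ) where
  toFun w l l' := ∑ i, ∑ j, symContract (B i l) (symContract (C j l') (w i j))
  map_add' z w := by ext l l' : 2; simp [sum_add_distrib]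
  map_smul' t z := by ext l l' : 2; simp [smul_sum]

theorem contractSum₂_apply (B C : J → κ → ι → ℝ) (w : J → J → Sym ι (k + 2) → ℝ) (l l' : κ) :
    contractSum₂ B C w l l' =
      ∑ i, ∑ j, symContract (B i l) (symContract (C j l') (w i j)) := rfl

/-- No nonzero antisymmetric family of symmetric tensors is killed by `contractSum₂ B B`. -/
def ContractSum₂Injective (k : ℕ) (B : J → κ → ι → ℝ) : Prop :=
  ∀ w : J → J → Sym ι (k + 2) → ℝ, (∀ i j, w i j + w j i = 0) →
    contractSum₂ B B w = 0 → w = 0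

/-- If the contraction operators of `B` are injective in the relevant degrees, the linear system
`A + ∑ j, c j • B j` becomes singular for some real `c`. -/
theorem exists_singular_of_injective [DecidableEq ι] [Fintype κ]
    (A : κ → ι → ℝ) (B : J → κ → ι → ℝ)
    (hodd : Odd (Fintype.card (Sym ι (k + 2))))
    (hcard : Fintype.card J * Fintype.card (Sym ι (k + 2)) =
      Fintype.card κ * Fintype.card (Sym ι (k + 1)))
    (h₁ : Function.Injective (contractSum (k := k + 1) B))
    (h₂ : ContractSum₂Injective k B) :
    ∃ c : J → ℝ, ∃ u : ι → ℝ, u ≠ 0 ∧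
      ∀ l, ∑ b, A l b * u b + ∑ j, c j * ∑ b, B j l b * u b = 0 := by
  let Φ := LinearEquiv.ofInjectiveOfFinrankEq (contractSum (k := k + 1) B) h₁
    (by simpa [Module.finrank_pi_fintype, Module.finrank_fintype_fun_eq_card] using hcard)
  have hΦ : ∀ z, Φ z = contractSum B z := fun z => rfl
  let α : (Sym ι (k + 2) → ℝ) →ₗ[ℝ] (κ → Sym ι (k + 1) → ℝ) :=
    LinearMap.pi fun l => symContract (A l)
  let Γ : J → Module.End ℝ (Sym ι (k + 2) → ℝ) := fun j =>
    LinearMap.proj j ∘ₗ Φ.symm.toLinearMap ∘ₗ (-α)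
  have hΓ : ∀ z l, ∑ j, symContract (B j l) (Γ j z) = - symContract (A l) z := by
    intro z l
    have : contractSum B (Φ.symm (-α z)) = -α z := by rw [← hΦ, Φ.apply_symm_apply]
    exact congrFun this l
  have hdouble : ∀ z l l', ∑ i, ∑ j, symContract (B i l) (symContract (B j l') (Γ i (Γ j z))) =
      symContract (A l) (symContract (A l') z) := by
    intro z l l'
    rw [sum_comm]
    calc _ = ∑ j, symContract (B j l') (∑ i, symContract (B i l) (Γ i (Γ j z))) := by
            simp_rw [map_sum, symContract_comm (B _ l)]
      _ = -symContract (A l) (∑ j, symContract (B j l') (Γ j z)) := by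
            rw [map_sum, ← sum_neg_distrib]
            refine sum_congr rfl fun j _ => ?_
            rw [hΓ, map_neg, symContract_comm]
      _ = _ := by rw [hΓ, map_neg, neg_neg]
  have hcomm : ∀ i j z, Γ i (Γ j z) = Γ j (Γ i z) := by
    intro i j z
    have hw := h₂ (fun i j => Γ i (Γ j z) - Γ j (Γ i z)) (fun i j => by abel) (by
      ext l l' : 2
      simp only [contractSum₂_apply, map_sub, sum_sub_distrib, hdouble]
      have hswap := hdouble z l' l
      rw [sum_comm, symContract_comm] at hswap
      simp_rw [symContract_comm (B _ l) (B _ l'), hswap]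
      simp)
    exact sub_eq_zero.mp (congrFun (congrFun hw i) j)
  obtain ⟨z, hz, c, hc⟩ := Module.End.exists_common_eigenvector_of_odd_finrank
    (by rwa [Module.finrank_fintype_fun_eq_card]) Γ hcomm
  obtain ⟨s, hs⟩ := Function.ne_iff.mp hz
  obtain ⟨a, s, rfl⟩ := s.exists_eq_cons_of_succ
  refine ⟨c, fun b => z (b ::ₛ s), fun h => hs (congrFun h a), fun l => ?_⟩
  have := congrFun (hΓ z l) s
  simp only [hc, map_smul, Finset.sum_apply, Pi.smul_apply, Pi.neg_apply, smul_eq_mul,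
    symContract_apply] at this
  linarith

theorem contractSum_add_smul (B C : J → κ → ι → ℝ) (t : ℝ) :
    contractSum (k := k) (B + t • C) = contractSum B + t • contractSum C := by
  ext z l : 2
  simp [contractSum_apply, symContract_add, symContract_smul, sum_add_distrib, smul_sum]

theorem contractSum₂_add_smul (B C : J → κ → ι → ℝ) (t : ℝ) :
    contractSum₂ (k := k) (B + t • C) (B + t • C) = contractSum₂ B B +
      t • (contractSum₂ B C + contractSum₂ C B) + t ^ 2 • contractSum₂ C C := by
  ext w l l' : 3
  simp only [contractSum₂_apply, Pi.add_apply, Pi.smul_apply, symContract_add, symContract_smul,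
    map_add, map_smul, sum_add_distrib, smul_add, LinearMap.add_apply, LinearMap.smul_apply,
    ← smul_sum]
  module

theorem eventually_contractSum_injective [DecidableEq ι] (B C : J → κ → ι → ℝ)
    (hB : Function.Injective (contractSum (k := k) B)) :
    ∀ᶠ t : ℝ in Filter.atTop, Function.Injective (contractSum (k := k) (B + t • C)) := by
  filter_upwards [LinearMap.eventually_injective_quadratic _ (contractSum C) 0 hB] with t ht
  rw [contractSum_add_smul]
  simpa using ht

theorem eventually_contractSum₂Injective [DecidableEq ι] (B C : J → κ → ι → ℝ)
    (hB : ContractSum₂Injective k B) :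
    ∀ᶠ t : ℝ in Filter.atTop, ContractSum₂Injective k (B + t • C) := by
  let S : (J → J → Sym ι (k + 2) → ℝ) →ₗ[ℝ] (J → J → Sym ι (k + 2) → ℝ) :=
    { toFun := fun w i j => w i j + w j i
      map_add' := fun v w => by ext i j : 2; simp only [Pi.add_apply]; abel
      map_smul' := fun t w => by ext i j : 2; simp }
  have hS : ∀ w i j, S w i j = w i j + w j i := fun w i j => rfl
  have hinj : Function.Injective (S.prod (contractSum₂ B B)) := by
    rw [injective_iff_map_eq_zero]
    intro w hw
    obtain ⟨hw₁, hw₂⟩ := Prod.ext_iff.mp hw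
    exact hB w (fun i j => congrFun (congrFun hw₁ i) j) hw₂
  filter_upwards [LinearMap.eventually_injective_quadratic _
    (LinearMap.prod 0 (contractSum₂ B C + contractSum₂ C B))
    (LinearMap.prod 0 (contractSum₂ C C)) hinj] with t ht w hw₁ hw₂
  refine (injective_iff_map_eq_zero _).mp ht w (Prod.ext ?_ ?_)
  · ext i j : 2
    simpa [hS] using hw₁ i j
  · rw [contractSum₂_add_smul] at hw₂
    simpa using hw₂

end

/-! ### The model system -/

/-- Twice the sum of `max a c` over unordered pairs of entries of a multiset. -/
def Multiset.pairMaxSum (s : Multiset ℤ) : ℤ :=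
  (s.map fun a => (s.map fun c => max a c).sum).sum - s.sum

theorem Multiset.pairMaxSum_cons (b : ℤ) (s : Multiset ℤ) :
    (b ::ₘ s).pairMaxSum = s.pairMaxSum + 2 * (s.map fun c => max b c).sum := by
  simp only [pairMaxSum, map_cons, sum_cons, sum_map_add, max_self, max_comm _ b]
  ring

theorem Multiset.le_sum_map_max_of_forall_le (s : Multiset ℤ) (b b' : ℤ) (h : ∀ c ∈ s, c ≤ b) :
    (s.map fun c => max b c).sum + card s * (b' - b) ≤ (s.map fun c => max b' c).sum := by
  induction s using Multiset.induction_on with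
  | empty => simp
  | cons a s ih =>
    have h₁ := ih fun c hc => h c (mem_cons_of_mem hc)
    have h₂ := h a (mem_cons_self a s)
    simp only [map_cons, sum_cons, card_cons, max_eq_left h₂]
    push_cast
    have := le_max_left b' a
    linarith

theorem Multiset.le_sum_map_max_of_forall_ge (s : Multiset ℤ) (b b' : ℤ) (h : ∀ c ∈ s, b ≤ c) :
    (s.map fun c => max b c).sum ≤ (s.map fun c => max b' c).sum := by
  refine sum_map_le_sum_map _ _ fun c hc => ?_
  rw [max_eq_right (h c hc)]
  exact le_max_right _ _

/-- Splitting off the entry of rank `j`. -/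
theorem Multiset.exists_eq_cons_add {α : Type*} [LinearOrder α] (s : Multiset α) {j : ℕ}
    (hj : j < card s) : ∃ b S T, s = b ::ₘ (S + T) ∧ card S = j ∧
      (∀ c ∈ S, c ≤ b) ∧ ∀ c ∈ T, b ≤ c := by
  set L := s.sort (· ≤ ·) with hL
  have hLs : (L : Multiset α) = s := s.sort_eq (· ≤ ·)
  have hjL : j < L.length := by rw [hL, length_sort]; exact hj
  have hsplit : L = L.take j ++ L[j] :: L.drop (j + 1) := by
    rw [← List.drop_eq_getElem_cons hjL, List.take_append_drop]
  have hsorted : L.Pairwise (· ≤ ·) := s.pairwise_sort (· ≤ ·)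
  rw [hsplit, List.pairwise_append, List.pairwise_cons] at hsorted
  refine ⟨L[j], L.take j, L.drop (j + 1), ?_, by simp [hjL.le], ?_, ?_⟩
  · rw [← hLs, coe_add, cons_coe, coe_eq_coe]
    conv_lhs => rw [hsplit]
    exact List.perm_middle
  · exact fun c hc => hsorted.2.2 c hc _ List.mem_cons_self
  · exact fun c hc => hsorted.2.1.1 c hc

/-- The potential of a symmetric multi-index. -/
def symPotential {m k : ℕ} (s : Sym (Fin (m + 1)) k) : ℤ :=
  ((s : Multiset (Fin (m + 1))).map fun a : Fin (m + 1) => ((a : ℕ) : ℤ)).pairMaxSum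

theorem exists_cons_symPotential_le {m k : ℕ} (s : Sym (Fin (m + 1)) (k + 1)) (j : Fin (k + 1)) :
    ∃ b t, s = b ::ₛ t ∧ ∀ b' : Fin (m + 1),
      symPotential s + 2 * j * ((b' : ℤ) - b) ≤ symPotential (b' ::ₛ t) := by
  obtain ⟨b, S, T, hs, hS, hSb, hbT⟩ :=
    (s : Multiset (Fin (m + 1))).exists_eq_cons_add (j := j) (by simpa using j.is_le)
  have hcard : Multiset.card (S + T) = k := by
    have := congrArg Multiset.card hs
    simp at this
    simpa using this.symm
  obtain ⟨t, ht⟩ : ∃ t : Sym (Fin (m + 1)) k, (t : Multiset (Fin (m + 1))) = S + T :=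
    ⟨Sym.mk _ hcard, rfl⟩
  obtain rfl : s = b ::ₛ t := Sym.coe_injective (by rw [hs, Sym.coe_cons, ht])
  refine ⟨b, _, rfl, fun b' => ?_⟩
  have h₁ := (S.map fun a : Fin (m + 1) => ((a : ℕ) : ℤ)).le_sum_map_max_of_forall_le b b'
    (by simpa using hSb)
  have h₂ := (T.map fun a : Fin (m + 1) => ((a : ℕ) : ℤ)).le_sum_map_max_of_forall_ge b b'
    (by simpa using hbT)
  simp only [Multiset.card_map, hS] at h₁
  simp only [symPotential, Sym.coe_cons, Multiset.map_cons, Multiset.pairMaxSum_cons,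
    ht, Multiset.map_add, Multiset.sum_add]
  linarith

theorem exists_cons_cons_symPotential_le {m k : ℕ} (s : Sym (Fin (m + 1)) (k + 2))
    (i j : Fin (k + 2)) (hij : i < j) :
    ∃ b c t, s = b ::ₛ c ::ₛ t ∧ ∀ b' c' : Fin (m + 1),
      symPotential s + 2 * i * ((b' : ℤ) - b) + 2 * j * ((c' : ℤ) - c) ≤
        symPotential (b' ::ₛ c' ::ₛ t) := by
  obtain ⟨c, S, R, hs, hS, hSc, hcR⟩ :=
    (s : Multiset (Fin (m + 1))).exists_eq_cons_add (j := j) (by simp)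
  obtain ⟨b, Q, T, rfl, hQ, hQb, hbT⟩ := S.exists_eq_cons_add (j := i) (by rw [hS]; exact hij)
  have hbc : b ≤ c := hSc b (by simp)
  have hQT : ∀ e ∈ Q + T, e ≤ c := fun e he => hSc e (Multiset.mem_cons_of_mem he)
  have hcard : Multiset.card (Q + T + R) = k := by
    have := congrArg Multiset.card hs
    simp at this
    simp
    omega
  have hTcard : (Multiset.card (Q + T) : ℤ) = j - 1 := by
    rw [Multiset.card_cons] at hS
    omega
  obtain ⟨t, ht⟩ : ∃ t : Sym (Fin (m + 1)) k, (t : Multiset (Fin (m + 1))) = Q + T + R :=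
    ⟨Sym.mk _ hcard, rfl⟩
  obtain rfl : s = b ::ₛ c ::ₛ t := Sym.coe_injective (by
    rw [hs, Sym.coe_cons, Sym.coe_cons, ht, Multiset.cons_add, Multiset.cons_swap])
  refine ⟨b, c, _, rfl, fun b' c' => ?_⟩
  let f : Fin (m + 1) → ℤ := fun a => ((a : ℕ) : ℤ)
  have h₁ := (Q.map f).le_sum_map_max_of_forall_le b b' (by simpa [f] using hQb)
  have h₂ := ((T + R).map f).le_sum_map_max_of_forall_ge b b' (by
    have : ∀ e ∈ T + R, b ≤ e := fun e he => (Multiset.mem_add.mp he).elim (hbT e)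
      fun he => hbc.trans (hcR e he)
    simpa only [Multiset.forall_mem_map_iff, f, Nat.cast_le, Fin.val_fin_le] using this)
  have h₃ := ((Q + T).map f).le_sum_map_max_of_forall_le c c' (by
    simpa only [Multiset.forall_mem_map_iff, f, Nat.cast_le, Fin.val_fin_le] using hQT)
  have h₄ := (R.map f).le_sum_map_max_of_forall_ge c c' (by simpa [f] using hcR)
  have h₅ : max (b : ℤ) c = c := max_eq_right (by exact_mod_cast hbc)
  have h₆ : (c' : ℤ) ≤ max (b' : ℤ) c' := le_max_right _ _
  rw [Multiset.card_map, hTcard] at h₃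
  simp only [Multiset.card_map, hQ, Multiset.map_add, Multiset.sum_add, f] at h₁ h₂ h₃ h₄
  simp only [symPotential, Sym.coe_cons, Multiset.map_cons, Multiset.pairMaxSum_cons,
    ht, Multiset.map_add, Multiset.sum_add, Multiset.sum_cons, h₅]
  linarith

/-- The structure constants of multiplication of polynomials of degree less than `k` with
polynomials of degree at most `m`. -/
def convolutionTensor (m k : ℕ) (j : Fin k) (l : Fin (m + k)) (b : Fin (m + 1)) : ℝ :=
  if (b : ℕ) + j = l then 1 else 0

theorem contractSum_convolutionTensor_injective (m k : ℕ) :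
    Function.Injective (contractSum (k := k) (convolutionTensor m (k + 1))) := by
  rw [injective_iff_map_eq_zero]
  intro z hz
  by_contra hne
  let E : Fin (k + 1) × Sym (Fin (m + 1)) (k + 1) → ℤ := fun q => symPotential q.2 + (q.1 : ℤ) ^ 2
  have hsupp : (univ.filter fun q : Fin (k + 1) × Sym (Fin (m + 1)) (k + 1) =>
      z q.1 q.2 ≠ 0).Nonempty := by
    by_contra hempty
    rw [not_nonempty_iff_eq_empty, filter_eq_empty_iff] at hempty
    exact hne (funext₂ fun j s => not_not.mp (hempty (mem_univ (j, s))))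
  obtain ⟨⟨j, s⟩, hmem, hmax⟩ := exists_max_image _ E hsupp
  obtain ⟨b, t, rfl, hpot⟩ := exists_cons_symPotential_le s j
  refine (mem_filter.mp hmem).2 ?_
  have hrel := congrFun (congrFun hz ⟨b + j, by omega⟩) t
  simp only [contractSum_apply, Finset.sum_apply, symContract_apply, convolutionTensor,
    ite_mul, one_mul, zero_mul, Pi.zero_apply] at hrel
  rw [← sum_product', sum_eq_single (j, b)] at hrel
  · simpa using hrel
  · rintro ⟨i, b'⟩ - hib
    simp only [ite_eq_right_iff]
    intro heq
    by_contra hz'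
    have hle := hmax (i, b' ::ₛ t) (by simpa using hz')
    have hpot' := hpot b'
    have hb' : (b' : ℤ) - b = j - i := by omega
    rw [hb'] at hpot'
    have hij : (j : ℤ) - i = 0 := by
      simp only [E] at hle
      nlinarith
    obtain rfl : i = j := Fin.ext (by omega)
    obtain rfl : b' = b := Fin.ext (by omega)
    exact hib rfl
  · simp

theorem contractSum₂Injective_convolutionTensor (m k : ℕ) :
    ContractSum₂Injective k (convolutionTensor m (k + 2)) := by
  intro w hanti hw
  by_contra hne
  let Idx := Fin (k + 2) × Fin (k + 2) × Sym (Fin (m + 1)) (k + 2)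
  let E : Idx → ℤ := fun q => symPotential q.2.2 + (q.1 : ℤ) ^ 2 + (q.2.1 : ℤ) ^ 2
  have hsupp : (univ.filter fun q : Idx => w q.1 q.2.1 q.2.2 ≠ 0).Nonempty := by
    by_contra hempty
    rw [not_nonempty_iff_eq_empty, filter_eq_empty_iff] at hempty
    exact hne (funext₃ fun i j s => not_not.mp (hempty (mem_univ (i, j, s))))
  obtain ⟨⟨i, j, s⟩, hmem, hmax⟩ := exists_max_image _ E hsupp
  have hanti' : ∀ i j s, w i j s = - w j i s := fun i j s =>
    eq_neg_of_add_eq_zero_left (congrFun (hanti i j) s)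
  wlog hij : i < j generalizing i j
  · have hwij : w i j s ≠ 0 := (mem_filter.mp hmem).2
    have hne' : i ≠ j := by
      rintro rfl
      exact hwij (by linarith [hanti' i i s])
    refine this j i (by simpa [hanti' j i s] using hwij) (fun q hq => ?_)
      (lt_of_le_of_ne (not_lt.mp hij) hne'.symm)
    have := hmax q hq
    simp only [E] at this ⊢
    linarith
  obtain ⟨b, c, t, rfl, hpot⟩ := exists_cons_cons_symPotential_le s i j hij
  refine (mem_filter.mp hmem).2 ?_
  have hrel := congrFun (congrFun (congrFun hw ⟨b + i, by omega⟩) ⟨c + j, by omega⟩) t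
  simp only [contractSum₂_apply, Finset.sum_apply, symContract_apply, mul_sum,
    Pi.zero_apply] at hrel
  have hzero : ∀ i' j' b' c', ¬(i' = i ∧ j' = j ∧ b' = b ∧ c' = c) →
      convolutionTensor m (k + 2) i' ⟨b + i, by omega⟩ b' *
        (convolutionTensor m (k + 2) j' ⟨c + j, by omega⟩ c' * w i' j' (c' ::ₛ b' ::ₛ t)) = 0 := by
    intro i' j' b' c' hdiff
    by_contra hne'
    obtain ⟨hc, hb, hw'⟩ : (c' : ℕ) + j' = c + j ∧ (b' : ℕ) + i' = b + i ∧
        w i' j' (c' ::ₛ b' ::ₛ t) ≠ 0 := by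
      simpa [convolutionTensor] using hne'
    rw [Sym.cons_swap] at hw'
    have hle := hmax (i', j', b' ::ₛ c' ::ₛ t) (by simpa using hw')
    have hpot' := hpot b' c'
    have hb' : (b' : ℤ) - b = i - i' := by omega
    have hc' : (c' : ℤ) - c = j - j' := by omega
    rw [hb', hc'] at hpot'
    simp only [E] at hle
    have hi : (i : ℤ) - i' = 0 := by nlinarith [sq_nonneg ((j : ℤ) - j')]
    have hj : (j : ℤ) - j' = 0 := by nlinarith [sq_nonneg ((i : ℤ) - i')]
    exact hdiff ⟨Fin.ext (by omega), Fin.ext (by omega), Fin.ext (by omega), Fin.ext (by omega)⟩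
  rw [Fintype.sum_eq_single i, Fintype.sum_eq_single j, Fintype.sum_eq_single b,
    Fintype.sum_eq_single c] at hrel
  · simpa [convolutionTensor, Sym.cons_swap c b] using hrel
  · exact fun c' hc' => hzero _ _ _ _ fun h => hc' h.2.2.2
  · exact fun b' hb' => sum_eq_zero fun c' _ => hzero _ _ _ _ fun h => hb' h.2.2.1
  · exact fun j' hj' => sum_eq_zero fun b' _ => sum_eq_zero fun c' _ =>
      hzero _ _ _ _ fun h => hj' h.2.1
  · exact fun i' hi' => sum_eq_zero fun j' _ => sum_eq_zero fun b' _ => sum_eq_zero fun c' _ =>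
      hzero _ _ _ _ fun h => hi' h.1

/-! ### Bilinear systems and division algebras -/

/-- The bilinear map with structure constants `a`. -/
def tensorBilin {J κ ι : Type*} [Fintype J] [Fintype ι] (a : J → κ → ι → ℝ)
    (x : J → ℝ) (u : ι → ℝ) (l : κ) : ℝ :=
  ∑ j, x j * ∑ b, a j l b * u b

theorem tensorBilin_smul_smul {J κ ι : Type*} [Fintype J] [Fintype ι] (a : J → κ → ι → ℝ)
    (r q : ℝ) (x : J → ℝ) (u : ι → ℝ) :
    tensorBilin a (r • x) (q • u) = (r * q) • tensorBilin a x u := by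
  ext l
  simp only [tensorBilin, Pi.smul_apply, smul_eq_mul, mul_sum]
  exact sum_congr rfl fun j _ => sum_congr rfl fun b _ => by ring

theorem tensorBilin_add_smul {J κ ι : Type*} [Fintype J] [Fintype ι] (a a' : J → κ → ι → ℝ)
    (t : ℝ) (x : J → ℝ) (u : ι → ℝ) :
    tensorBilin (a + t • a') x u = tensorBilin a x u + t • tensorBilin a' x u := by
  ext l
  simp [tensorBilin, mul_sum, add_mul, mul_add, sum_add_distrib, mul_left_comm, mul_assoc]

theorem continuous_tensorBilin {J κ ι : Type*} [Fintype J] [Fintype ι] (a : J → κ → ι → ℝ) :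
    Continuous fun p : (J → ℝ) × (ι → ℝ) => tensorBilin a p.1 p.2 := by
  unfold tensorBilin
  fun_prop

/-- If, for all large `t`, the system `a + t • a'` has a nontrivial zero, so does `a'`. -/
theorem exists_tensorBilin_eq_zero_of_eventually {J κ ι : Type*} [Fintype J] [Fintype κ]
    [Fintype ι] (a a' : J → κ → ι → ℝ)
    (h : ∀ᶠ t : ℝ in Filter.atTop, ∃ x ≠ 0, ∃ u ≠ 0, tensorBilin (a + t • a') x u = 0) :
    ∃ x ≠ 0, ∃ u ≠ 0, tensorBilin a' x u = 0 := by
  by_contra! hne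
  let K : Set ((J → ℝ) × (ι → ℝ)) := Metric.sphere 0 1 ×ˢ Metric.sphere 0 1
  have hK : IsCompact K := (isCompact_sphere _ _).prod (isCompact_sphere _ _)
  have hunit : ∀ᶠ t : ℝ in Filter.atTop, ∃ p ∈ K, tensorBilin (a + t • a') p.1 p.2 = 0 := by
    filter_upwards [h] with t ⟨x, hx, u, hu, hxu⟩
    refine ⟨(‖x‖⁻¹ • x, ‖u‖⁻¹ • u), ⟨?_, ?_⟩, ?_⟩
    · simp [norm_smul, hx]
    · simp [norm_smul, hu]
    · simp [tensorBilin_smul_smul, hxu]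
  have hKne : K.Nonempty := hunit.exists.elim fun _ ⟨p, hp, _⟩ => ⟨p, hp⟩
  obtain ⟨p, hp, hmin⟩ := hK.exists_isMinOn hKne (continuous_tensorBilin a').norm.continuousOn
  obtain ⟨q, -, hmax⟩ := hK.exists_isMaxOn hKne (continuous_tensorBilin a).norm.continuousOn
  have hpos : 0 < ‖tensorBilin a' p.1 p.2‖ :=
    norm_pos_iff.mpr (hne p.1 (ne_zero_of_mem_unit_sphere ⟨_, hp.1⟩) p.2
      (ne_zero_of_mem_unit_sphere ⟨_, hp.2⟩))
  obtain ⟨t, ⟨r, hr, hzero⟩, htpos, htlarge⟩ := (hunit.and ((Filter.eventually_gt_atTop 0).and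
    (Filter.eventually_gt_atTop (‖tensorBilin a q.1 q.2‖ / ‖tensorBilin a' p.1 p.2‖)))).exists
  rw [tensorBilin_add_smul] at hzero
  have hnorm : ‖tensorBilin a r.1 r.2‖ = t * ‖tensorBilin a' r.1 r.2‖ := by
    rw [eq_neg_of_add_eq_zero_left hzero, norm_neg, norm_smul, Real.norm_of_nonneg htpos.le]
  have h₁ : ‖tensorBilin a' p.1 p.2‖ ≤ ‖tensorBilin a' r.1 r.2‖ := hmin hr
  have h₂ : ‖tensorBilin a r.1 r.2‖ ≤ ‖tensorBilin a q.1 q.2‖ := hmax hr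
  rw [div_lt_iff₀ hpos] at htlarge
  nlinarith

/-- A system of `m + k + 2` real bilinear equations in `k + 3` and `m + 1` unknowns has a
nontrivial zero if the binomial coefficient `(m + k + 2).choose (k + 2)` is odd. -/
theorem exists_tensorBilin_eq_zero_of_odd_choose {m k : ℕ}
    (hodd : Odd ((m + (k + 2)).choose (k + 2)))
    (a : Fin (k + 2 + 1) → Fin (m + (k + 2)) → Fin (m + 1) → ℝ) :
    ∃ x ≠ 0, ∃ u ≠ 0, tensorBilin a x u = 0 := by
  have hcard : ∀ r, Fintype.card (Sym (Fin (m + 1)) r) = (m + r).choose r := fun r => by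
    rw [Sym.card_sym_eq_choose, Fintype.card_fin, Nat.add_right_comm, Nat.add_sub_cancel]
  let ν : Fin (k + 2 + 1) → Fin (m + (k + 2)) → Fin (m + 1) → ℝ :=
    Fin.cons 0 (convolutionTensor m (k + 2))
  apply exists_tensorBilin_eq_zero_of_eventually ν
  filter_upwards [eventually_contractSum_injective _ (Fin.tail a)
      (contractSum_convolutionTensor_injective m (k + 1)),
    eventually_contractSum₂Injective _ (Fin.tail a)
      (contractSum₂Injective_convolutionTensor m k)] with t h₁ h₂
  obtain ⟨c, u, hu, hc⟩ := exists_singular_of_injective (t • a 0) _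
    (by rwa [hcard]) (by
      rw [hcard, hcard, Fintype.card_fin, Fintype.card_fin, mul_comm]
      exact (Nat.add_one_mul_choose_eq (m + (k + 1)) (k + 1)).symm) h₁ h₂
  refine ⟨Fin.cons 1 c, fun h => one_ne_zero (congrFun h 0), u, hu, funext fun l => ?_⟩
  simpa [tensorBilin, Fin.sum_univ_succ (n := k + 2), ν, Fin.tail] using hc l

theorem odd_choose_two_pow_mul {b : ℕ} (hb : Odd b) (a : ℕ) :
    Odd ((2 ^ a * b).choose (2 ^ a)) := by
  induction a with
  | zero => simpa using hb
  | succ a ih =>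
    have := Choose.choose_modEq_choose_mod_mul_choose_div_nat (p := 2)
      (n := 2 ^ (a + 1) * b) (k := 2 ^ (a + 1))
    have hn : 2 ^ (a + 1) * b = 2 * (2 ^ a * b) := by ring
    have hk : 2 ^ (a + 1) = 2 * 2 ^ a := by ring
    rw [hn, hk] at this ⊢
    simp only [Nat.mul_mod_right, Nat.choose_self, one_mul, Nat.ofNat_pos,
      Nat.mul_div_cancel_left] at this
    rw [Nat.odd_iff] at ih ⊢
    exact Eq.trans this ih

theorem exists_odd_choose_of_ne_two_pow {n : ℕ} (hn : n ≠ 0) (h : ∀ a, n ≠ 2 ^ a) :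
    ∃ k, 2 ≤ k ∧ k < n ∧ Odd (n.choose k) := by
  obtain ⟨a, b, hb, rfl⟩ := Nat.exists_eq_two_pow_mul_odd hn
  have hb1 : b ≠ 1 := fun hb1 => h a (by simp [hb1])
  have hb2 : 2 < b := by
    obtain ⟨c, rfl⟩ := hb
    omega
  rcases a with _ | a
  · refine ⟨b - 1, by omega, by omega, ?_⟩
    rw [pow_zero, one_mul, Nat.choose_symm (by omega : 1 ≤ b), Nat.choose_one_right]
    exact hb
  · refine ⟨2 ^ (a + 1), ?_, ?_, odd_choose_two_pow_mul hb _⟩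
    · exact Nat.le_self_pow (by omega) 2
    · have : 0 < 2 ^ (a + 1) := by positivity
      nlinarith

theorem stiefel_division_algebras (n : ℕ) (hn : n ≠ 0)
    (μ : (Fin n → ℝ) →ₗ[ℝ] (Fin n → ℝ) →ₗ[ℝ] (Fin n → ℝ))
    (hμ : ∀ x y : Fin n → ℝ, μ x y = 0 → x = 0 ∨ y = 0) :
    ∃ k : ℕ, n = 2 ^ k := by
  by_contra! hpow
  obtain ⟨k, hk2, hkn, hodd⟩ := exists_odd_choose_of_ne_two_pow hn hpow
  obtain ⟨k, rfl⟩ := Nat.exists_eq_add_of_le' hk2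
  obtain ⟨m, rfl⟩ := Nat.exists_eq_add_of_le' hkn.le
  let extend : ∀ {r : ℕ}, r ≤ m + (k + 2) → (Fin r → ℝ) → Fin (m + (k + 2)) → ℝ :=
    fun h x => ∑ j, x j • Pi.single (Fin.castLE h j) 1
  have extend_eq_zero : ∀ {r : ℕ} (h : r ≤ m + (k + 2)) (x : Fin r → ℝ),
      extend h x = 0 → x = 0 := by
    intro r h x hx
    ext j
    simpa [extend, Finset.sum_apply, Pi.single_apply, Fin.castLE_inj] using
      congrFun hx (Fin.castLE h j)
  have hx : k + 2 + 1 ≤ m + (k + 2) := by omega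
  have hu : m + 1 ≤ m + (k + 2) := by omega
  obtain ⟨x, hx0, u, hu0, hxu⟩ := exists_tensorBilin_eq_zero_of_odd_choose hodd fun j l b =>
    μ (Pi.single (Fin.castLE hx j) 1) (Pi.single (Fin.castLE hu b) 1) l
  have hzero : μ (extend hx x) (extend hu u) = 0 := by
    rw [← hxu]
    ext l
    simp [extend, tensorBilin, LinearMap.sum_apply, Finset.sum_apply, mul_comm (u _), sum_mul, mul_sum,
      mul_assoc]
    exact sum_comm
  rcases hμ _ _ hzero with h | h
  · exact hx0 (extend_eq_zero hx x h)
  · exact hu0 (extend_eq_zero hu u h)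
end

section
/- The fundamental theorem of topology (degree classification of circle maps): every continuous map S¹ → S¹ is homotopic to exactly one of the maps w_d : z ↦ z^d with d ∈ ℤ; consequently the assignment [w_d] ↦ d is a bijection between the set [S¹,S¹] of homotopy classes of continuous maps S¹ → S¹ and ℤ. -/
/-!
STATEMENT 8 (the fundamental theorem of topology, degree classification of
circle maps): every continuous map S¹ → S¹ is homotopic to exactly one of the
maps w_d : z ↦ z^d with d ∈ ℤ; consequently [S¹, S¹] is in bijection with ℤ
via [w_d] ↦ d.
-/

/-- The `d`-fold winding map `w_d : z ↦ z ^ d` on the circle. -/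
noncomputable def windingMap (d : ℤ) : C(Circle, Circle) :=
  ⟨fun z => z ^ d, continuous_zpow d⟩

open Real unitInterval

@[simp]
lemma windingMap_apply (d : ℤ) (z : Circle) : windingMap d z = z ^ d := rfl

/-- A circle-valued map that is homotopic to a constant factors through `Circle.exp`. -/
lemma exists_circleExp_comp_eq_of_homotopic_one {X : Type*} [TopologicalSpace X]
    {h : C(X, Circle)} (hh : (1 : C(X, Circle)).Homotopic h) :
    ∃ g : C(X, ℝ), ∀ x, Circle.exp (g x) = h x := by
  obtain ⟨H⟩ := hh
  have H_zero : ∀ x, H.toContinuousMap (0, x) = Circle.exp ((0 : C(X, ℝ)) x) := fun x ↦ by simp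
  let L := Circle.isCoveringMap_exp.liftHomotopy H.toContinuousMap 0 H_zero
  refine ⟨L.comp ((ContinuousMap.const X 1).prodMk (.id X)), fun x ↦ ?_⟩
  have hL := congr_fun (Circle.isCoveringMap_exp.liftHomotopy_lifts H.toContinuousMap 0 H_zero)
    ((1 : I), x)
  exact hL.trans (H.apply_one x)

/-- A winding map with a continuous logarithm has degree zero. -/
lemma eq_zero_of_circleExp_comp_eq_zpow {n : ℤ} {g : C(Circle, ℝ)}
    (hg : ∀ z, Circle.exp (g z) = z ^ n) : n = 0 := by
  have key : (fun x : ℝ ↦ g (Circle.exp x)) = fun x ↦ n * x + g 1 :=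
    Circle.isCoveringMap_exp.eq_of_comp_eq (by fun_prop) (by fun_prop)
      (by ext1 x; simp [hg, Circle.exp_add]) 0 (by simp)
  have h := congr_fun key (2 * π)
  simpa [pi_ne_zero] using h

lemma eq_of_windingMap_homotopic {d e : ℤ}
    (h : (windingMap d).Homotopic (windingMap e)) : d = e := by
  obtain ⟨H⟩ := h
  have hone : (1 : C(Circle, Circle)).Homotopic (windingMap (e - d)) :=
    ⟨{ toFun := fun p ↦ H p * (p.2 ^ d)⁻¹
       continuous_toFun := by fun_prop
       map_zero_left := fun z ↦ by simp
       map_one_left := fun z ↦ by simp [zpow_sub] }⟩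
  obtain ⟨g, hg⟩ := exists_circleExp_comp_eq_of_homotopic_one hone
  have := eq_zero_of_circleExp_comp_eq_zpow hg
  omega

/-- Every circle map is a winding map times a map with a continuous logarithm. -/
lemma exists_eq_circleExp_mul_zpow (f : C(Circle, Circle)) :
    ∃ (d : ℤ) (g : C(Circle, ℝ)), ∀ z, f z = Circle.exp (g z) * z ^ d := by
  obtain ⟨y, hy⟩ := Circle.exp_surjective (f 1)
  obtain ⟨F, ⟨-, hF⟩, -⟩ := Circle.isCoveringMap_exp.existsUnique_continuousMap_lifts
    (f.comp Circle.exp) 0 y (by simpa using hy)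
  replace hF : ∀ x, Circle.exp (F x) = f (Circle.exp x) := congr_fun hF
  obtain ⟨d, hd⟩ := Circle.exp_eq_exp.1
    (show Circle.exp (F (2 * π)) = Circle.exp (F 0) by simp [hF])
  have hper : (fun x ↦ F (x + 2 * π)) = fun x ↦ F x + d * (2 * π) :=
    Circle.isCoveringMap_exp.eq_of_comp_eq (by fun_prop) (by fun_prop)
      (by ext1 x; simp [hF, Circle.exp_add]) 0 (by simpa using hd)
  let G : C(ℝ, ℝ) := ⟨fun x ↦ F x - d * x, by fun_prop⟩
  have hG : Function.Periodic G (2 * π) := fun x ↦ by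
    have := congr_fun hper x
    simp only [G, ContinuousMap.coe_mk] at this ⊢
    rw [this]
    ring
  have hfac : Function.FactorsThrough G Circle.exp := fun a b hab ↦ by
    obtain ⟨m, rfl⟩ := Circle.exp_eq_exp.1 hab
    exact hG.int_mul m b
  have hq : Topology.IsQuotientMap Circle.exp :=
    Circle.isCoveringMap_exp.isQuotientMap Circle.exp_surjective
  refine ⟨d, hq.lift G hfac, fun z ↦ ?_⟩
  obtain ⟨x, rfl⟩ := Circle.exp_surjective z
  have hx : hq.lift G hfac (Circle.exp x) = F x - d * x :=
    DFunLike.congr_fun (hq.lift_comp G hfac) x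
  rw [hx, Circle.exp_sub, Circle.exp_intCast_mul, hF, div_mul_cancel]

lemma exists_homotopic_windingMap (f : C(Circle, Circle)) :
    ∃ d : ℤ, f.Homotopic (windingMap d) := by
  obtain ⟨d, g, hfg⟩ := exists_eq_circleExp_mul_zpow f
  exact ⟨d, ⟨{
    toFun := fun p ↦ Circle.exp ((1 - (p.1 : ℝ)) * g p.2) * p.2 ^ d
    continuous_toFun := by fun_prop
    map_zero_left := fun z ↦ by simp [hfg]
    map_one_left := fun z ↦ by simp }⟩⟩

theorem degree_classification_of_circle_maps (f : C(Circle, Circle)) :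
    ∃! d : ℤ, f.Homotopic (windingMap d) := by
  obtain ⟨d, hd⟩ := exists_homotopic_windingMap f
  exact ⟨d, hd, fun e he ↦ eq_of_windingMap_homotopic (he.symm.trans hd)⟩
end

section
/- Hopf's theorem for graphs: if K is the topological realization of a finite connected graph with V vertices and E edges, then the set [K,S¹] of homotopy classes of continuous maps K → S¹ is in bijection with ℤ^{E−V+1}. In particular, for a wedge of k circles, the homotopy classes of maps to S¹ are in bijection with ℤ^k via the degrees of the restrictions to the k circles. -/
/-!
STATEMENT 9 (Hopf's theorem for graphs): if K is the topological realization of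
a finite connected graph with V vertices and E edges, then the set [K, S¹] of
homotopy classes of continuous maps K → S¹ is in bijection with ℤ^{E−V+1}.

A finite graph (loops and multiple edges allowed) is given by a finite vertex
type, a finite edge type and two endpoint maps; its topological realization is
the quotient of (vertices) ⊔ (edges × [0,1]) — vertices and edge-indices being
discrete — gluing the endpoints of each arc to the corresponding vertices.
The bijection between the set of homotopy classes and ℤ^{E−V+1} is expressed by
a map Φ defined on C(K, S¹) which is surjective and identifies exactly the
homotopic maps.  (For a connected graph, E − V + 1 = E + 1 − V ≥ 0.)
-/

open unitInterval

/-- The gluing relation for the topological realization of the graph with endpoint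
maps `s, t : E → V`. -/
def graphRel {V E : Type} (s t : E → V) (a b : V ⊕ E × I) : Prop :=
  (∃ e : E, a = Sum.inl (s e) ∧ b = Sum.inr (e, 0)) ∨
  (∃ e : E, a = Sum.inl (t e) ∧ b = Sum.inr (e, 1))

/-- The topological realization of the finite graph with vertex set `V`, edge set `E`
and endpoint maps `s, t : E → V`: one arc for each edge, glued to its endpoints. -/
def GraphRealization {V E : Type} (s t : E → V) : Type :=
  Quot (graphRel s t)

instance {V E : Type} (s t : E → V) : TopologicalSpace (GraphRealization s t) :=
  letI : TopologicalSpace V := ⊥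
  letI : TopologicalSpace E := ⊥
  inferInstanceAs (TopologicalSpace (Quot (graphRel s t)))

namespace GraphRealization

variable {V E : Type} {s t : E → V}

/-- The point of the realization given by a vertex. -/
def vertex (s t : E → V) (v : V) : GraphRealization s t :=
  Quot.mk _ (Sum.inl v)

/-- The arc of the realization given by an edge. -/
def arc (s t : E → V) (e : E) : C(I, GraphRealization s t) where
  toFun x := Quot.mk _ (Sum.inr (e, x))
  continuous_toFun := by
    let _ : TopologicalSpace V := ⊥
    let _ : TopologicalSpace E := ⊥
    exact continuous_quot_mk.comp (continuous_inr.comp (Continuous.prodMk_right e))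

lemma arc_zero (e : E) : arc s t e 0 = vertex s t (s e) :=
  (Quot.sound (r := graphRel s t) (Or.inl ⟨e, rfl, rfl⟩)).symm

lemma arc_one (e : E) : arc s t e 1 = vertex s t (t e) :=
  (Quot.sound (r := graphRel s t) (Or.inr ⟨e, rfl, rfl⟩)).symm

lemma vertex_or_arc (p : GraphRealization s t) :
    (∃ v, p = vertex s t v) ∨ ∃ e x, p = arc s t e x := by
  obtain ⟨v | ⟨e, x⟩, rfl⟩ := Quot.exists_rep p
  exacts [Or.inl ⟨v, rfl⟩, Or.inr ⟨e, x, rfl⟩]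

/-- The continuous map out of the realization given by its values at the vertices and along
the arcs. -/
def desc {X : Type*} [TopologicalSpace X] (φ : V → X) (L : E → C(I, X))
    (h0 : ∀ e, L e 0 = φ (s e)) (h1 : ∀ e, L e 1 = φ (t e)) :
    C(GraphRealization s t, X) where
  toFun := Quot.lift (Sum.elim φ fun p => L p.1 p.2) (by
    rintro _ _ (⟨e, rfl, rfl⟩ | ⟨e, rfl, rfl⟩)
    exacts [(h0 e).symm, (h1 e).symm])
  continuous_toFun := by
    let _ : TopologicalSpace V := ⊥
    let _ : TopologicalSpace E := ⊥
    have : DiscreteTopology V := ⟨rfl⟩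
    have : DiscreteTopology E := ⟨rfl⟩
    have hL : Continuous fun p : E × I => L p.1 p.2 :=
      continuous_prod_of_discrete_left.2 fun e => (L e).continuous
    exact continuous_quot_lift _ (continuous_of_discreteTopology.sumElim hL)

section desc

variable {X : Type*} [TopologicalSpace X] (φ : V → X) (L : E → C(I, X))
    (h0 : ∀ e, L e 0 = φ (s e)) (h1 : ∀ e, L e 1 = φ (t e))

@[simp] lemma desc_vertex (v : V) : desc φ L h0 h1 (vertex s t v) = φ v := rfl

@[simp] lemma desc_arc (e : E) (x : I) : desc φ L h0 h1 (arc s t e x) = L e x := rfl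

end desc

/-- A function on the vertices of a connected graph that takes equal values at the ends of each
edge is constant. -/
lemma eq_of_forall_edge [ConnectedSpace (GraphRealization s t)] {X : Type*} (n : V → X)
    (h : ∀ e, n (s e) = n (t e)) (v w : V) : n v = n w := by
  let _ : TopologicalSpace X := ⊥
  have : DiscreteTopology X := ⟨rfl⟩
  let F : C(GraphRealization s t, X) :=
    desc n (fun e => ContinuousMap.const I (n (s e))) (fun _ => rfl) h
  exact PreconnectedSpace.constant inferInstance F.continuous
    (x := vertex s t v) (y := vertex s t w)

lemma nonempty_vertices [ConnectedSpace (GraphRealization s t)] : Nonempty V := by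
  obtain ⟨p⟩ := (inferInstance : Nonempty (GraphRealization s t))
  obtain ⟨v, -⟩ | ⟨e, -, -⟩ := vertex_or_arc p
  exacts [⟨v⟩, ⟨s e⟩]

/-- The coboundary map from integral `0`-cochains to integral `1`-cochains. -/
def coboundary (s t : E → V) : (V → ℤ) →ₗ[ℤ] (E → ℤ) :=
  LinearMap.funLeft ℤ ℤ t - LinearMap.funLeft ℤ ℤ s

@[simp] lemma coboundary_apply (n : V → ℤ) (e : E) :
    coboundary s t n e = n (t e) - n (s e) := rfl

lemma mem_range_coboundary_of_zsmul_mem [ConnectedSpace (GraphRealization s t)] {k : ℤ}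
    (hk : k ≠ 0) {c : E → ℤ} (h : k • c ∈ LinearMap.range (coboundary s t)) :
    c ∈ LinearMap.range (coboundary s t) := by
  obtain ⟨n, hn⟩ := h
  have hn' : ∀ e, n (t e) - n (s e) = k * c e := fun e => congrFun hn e
  obtain ⟨v₀⟩ := nonempty_vertices (s := s) (t := t)
  have hdvd : ∀ v, k ∣ n v - n v₀ := fun v => by
    rw [← Int.modEq_iff_dvd]
    exact eq_of_forall_edge (s := s) (t := t) (fun v => n v % k)
      (fun e => Int.modEq_iff_dvd.2 ⟨c e, hn' e⟩) _ _
  choose m hm using hdvd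
  refine ⟨m, funext fun e => mul_left_cancel₀ hk ?_⟩
  rw [coboundary_apply, mul_sub, ← hm, ← hm, ← hn' e]
  ring

lemma isTorsionFree_coker_coboundary [ConnectedSpace (GraphRealization s t)] :
    Module.IsTorsionFree ℤ ((E → ℤ) ⧸ LinearMap.range (coboundary s t)) := by
  refine .of_smul_eq_zero fun k x hx => or_iff_not_imp_left.2 fun hk => ?_
  obtain ⟨c, rfl⟩ := Submodule.Quotient.mk_surjective _ x
  rw [← Submodule.Quotient.mk_smul, Submodule.Quotient.mk_eq_zero] at hx
  exact (Submodule.Quotient.mk_eq_zero _).2 (mem_range_coboundary_of_zsmul_mem hk hx)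

lemma ker_coboundary [ConnectedSpace (GraphRealization s t)] :
    LinearMap.ker (coboundary s t) = ℤ ∙ (1 : V → ℤ) := by
  obtain ⟨v₀⟩ := nonempty_vertices (s := s) (t := t)
  ext n
  rw [LinearMap.mem_ker, Submodule.mem_span_singleton]
  constructor
  · intro h
    refine ⟨n v₀, funext fun v => ?_⟩
    simpa using eq_of_forall_edge (s := s) (t := t) n
      (fun e => (sub_eq_zero.1 (congrFun h e)).symm) v₀ v
  · rintro ⟨a, rfl⟩
    ext e
    simp

lemma finrank_coker_coboundary [Fintype V] [Fintype E]
    [ConnectedSpace (GraphRealization s t)] :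
    Module.finrank ℤ ((E → ℤ) ⧸ LinearMap.range (coboundary s t)) =
      Fintype.card E + 1 - Fintype.card V := by
  have := nonempty_vertices (s := s) (t := t)
  have hker : Module.finrank ℤ (LinearMap.ker (coboundary s t)) = 1 := by
    rw [ker_coboundary]
    rw [← (LinearEquiv.toSpanNonzeroSingleton ℤ _ (1 : V → ℤ) one_ne_zero).finrank_eq,
      Module.finrank_self]
  have hrange := (LinearMap.ker (coboundary s t)).finrank_quotient_add_finrank
  have hquot := (LinearMap.range (coboundary s t)).finrank_quotient_add_finrank
  rw [(coboundary s t).quotKerEquivRange.finrank_eq, Module.finrank_fintype_fun_eq_card] at hrange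
  rw [Module.finrank_fintype_fun_eq_card] at hquot
  omega

/-- The integral cochain `c` measures the failure of the angles of `f` along the arcs to match
suitable angles at the vertices. -/
def IsWindingCochain (f : C(GraphRealization s t, Circle)) (c : E → ℤ) : Prop :=
  ∃ (θ : V → ℝ) (L : E → C(I, ℝ)), (∀ v, Circle.exp (θ v) = f (vertex s t v)) ∧
    (∀ e x, Circle.exp (L e x) = f (arc s t e x)) ∧ (∀ e, L e 0 = θ (s e)) ∧
    ∀ e, L e 1 = θ (t e) + c e * (2 * Real.pi)

lemma exists_isWindingCochain (f : C(GraphRealization s t, Circle)) :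
    ∃ c, IsWindingCochain f c := by
  choose θ hθ using fun v => Circle.exp_surjective (f (vertex s t v))
  choose L hL hL0 using fun e => Circle.isCoveringMap_exp.exists_path_lifts
    (f.comp (arc s t e)) (θ (s e)) (by simp [arc_zero, hθ])
  have hL' : ∀ e x, Circle.exp (L e x) = f (arc s t e x) := fun e x => congrFun (hL e) x
  have h1 : ∀ e, ∃ m : ℤ, L e 1 = θ (t e) + m * (2 * Real.pi) := fun e => by
    rw [← Circle.exp_eq_exp, hL', arc_one, hθ]
  choose c hc using h1
  exact ⟨c, θ, L, hθ, hL', hL0, hc⟩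

lemma exists_map_isWindingCochain (c : E → ℤ) :
    ∃ f : C(GraphRealization s t, Circle), IsWindingCochain f c := by
  let L : E → C(I, ℝ) := fun e => ⟨fun x => x * (c e * (2 * Real.pi)), by fun_prop⟩
  refine ⟨desc 1 (fun e => Circle.exp.comp (L e)) (fun e => by simp [L]) (fun e => ?_),
    0, L, fun v => by simp, fun e x => rfl, fun e => by simp [L], fun e => by simp [L]⟩
  exact Circle.exp_eq_one.2 ⟨c e, by simp [L]⟩

lemma IsWindingCochain.div {f g : C(GraphRealization s t, Circle)} {c d : E → ℤ}
    (hf : IsWindingCochain f c) (hg : IsWindingCochain g d) :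
    IsWindingCochain (f / g) (c - d) := by
  obtain ⟨θ, L, hθ, hL, h0, h1⟩ := hf
  obtain ⟨θ', L', hθ', hL', h0', h1'⟩ := hg
  refine ⟨θ - θ', L - L', fun v => by simp [Circle.exp_sub, hθ, hθ'],
    fun e x => by simp [Circle.exp_sub, hL, hL'], fun e => by simp [h0, h0'], fun e => ?_⟩
  simp only [Pi.sub_apply, ContinuousMap.sub_apply, h1, h1', Int.cast_sub]
  ring

lemma isWindingCochain_zero_iff {f : C(GraphRealization s t, Circle)} :
    IsWindingCochain f 0 ↔ ∃ h : C(GraphRealization s t, ℝ), Circle.exp.comp h = f := by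
  constructor
  · rintro ⟨θ, L, hθ, hL, h0, h1⟩
    refine ⟨desc θ L h0 fun e => by simpa using h1 e, ContinuousMap.ext fun p => ?_⟩
    obtain ⟨v, rfl⟩ | ⟨e, x, rfl⟩ := vertex_or_arc p
    exacts [hθ v, hL e x]
  · rintro ⟨h, rfl⟩
    exact ⟨fun v => h (vertex s t v), fun e => h.comp (arc s t e), fun v => rfl, fun e x => rfl,
      fun e => by simp [arc_zero], fun e => by simp [arc_one]⟩

lemma IsWindingCochain.add_coboundary {f : C(GraphRealization s t, Circle)} {c : E → ℤ}
    (hf : IsWindingCochain f c) (n : V → ℤ) : IsWindingCochain f (c + coboundary s t n) := by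
  obtain ⟨θ, L, hθ, hL, h0, h1⟩ := hf
  have hexp : ∀ (x : ℝ) (m : ℤ), Circle.exp (x - m * (2 * Real.pi)) = Circle.exp x :=
    fun x m => Circle.exp_eq_exp.2 ⟨-m, by push_cast; ring⟩
  refine ⟨fun v => θ v - n v * (2 * Real.pi),
    fun e => L e - ContinuousMap.const I (n (s e) * (2 * Real.pi)),
    fun v => by rw [hexp, hθ], fun e x => ?_, fun e => by simp [h0], fun e => ?_⟩
  · rw [ContinuousMap.sub_apply, ContinuousMap.const_apply, hexp, hL]
  · simp only [ContinuousMap.sub_apply, ContinuousMap.const_apply, h1, Pi.add_apply,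
      coboundary_apply, Int.cast_add, Int.cast_sub]
    ring

lemma IsWindingCochain.mem_range_coboundary {c : E → ℤ}
    (h : IsWindingCochain (1 : C(GraphRealization s t, Circle)) c) :
    c ∈ LinearMap.range (coboundary s t) := by
  obtain ⟨θ, L, hθ, hL, h0, h1⟩ := h
  choose n hn using fun v => Circle.exp_eq_one.1 (hθ v)
  have hconst : ∀ e, L e 1 = L e 0 := fun e =>
    Circle.isCoveringMap_exp.const_of_comp (L e).continuous
      (fun x y => (hL e x).trans (hL e y).symm) 1 0
  refine ⟨-n, funext fun e => ?_⟩
  have h := hconst e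
  rw [h0, h1, hn, hn, ← add_mul] at h
  have h' := mul_right_cancel₀ Real.two_pi_pos.ne' h
  norm_cast at h'
  simp only [coboundary_apply, Pi.neg_apply]
  omega

lemma IsWindingCochain.exists_lift_iff {f : C(GraphRealization s t, Circle)} {c : E → ℤ}
    (hf : IsWindingCochain f c) :
    (∃ h : C(GraphRealization s t, ℝ), Circle.exp.comp h = f) ↔
      c ∈ LinearMap.range (coboundary s t) := by
  rw [← isWindingCochain_zero_iff]
  constructor
  · intro h0
    have h := hf.div h0
    rw [div_self', sub_zero] at h
    exact h.mem_range_coboundary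
  · rintro ⟨n, rfl⟩
    simpa using hf.add_coboundary (-n)

end GraphRealization

/-- Two maps to the circle are homotopic exactly when their quotient has a continuous angle. -/
lemma Circle.homotopic_iff_exists_lift_div {X : Type*} [TopologicalSpace X] {f g : C(X, Circle)} :
    f.Homotopic g ↔ ∃ h : C(X, ℝ), Circle.exp.comp h = f / g := by
  constructor
  · intro hfg
    have hdiv : (1 : C(X, Circle)).Homotopic (f / g) := by
      obtain ⟨H⟩ := hfg.symm
      exact ⟨⟨⟨fun p => H p / g p.2, by fun_prop⟩, fun x => by simp, fun x => by simp⟩⟩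
    obtain ⟨H⟩ := hdiv
    have H0 : ∀ x, H.toContinuousMap (0, x) = Circle.exp ((0 : C(X, ℝ)) x) := fun x => by
      simp
    let G := Circle.isCoveringMap_exp.liftHomotopy H.toContinuousMap 0 H0
    refine ⟨G.comp ((ContinuousMap.const X 1).prodMk (ContinuousMap.id X)),
      ContinuousMap.ext fun x => ?_⟩
    exact (congrFun (Circle.isCoveringMap_exp.liftHomotopy_lifts H.toContinuousMap 0 H0)
      (1, x)).trans (H.apply_one x)
  · rintro ⟨h, hh⟩
    have hx : ∀ x, Circle.exp (h x) = f x / g x := fun x => DFunLike.congr_fun hh x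
    refine ContinuousMap.Homotopic.symm ⟨⟨⟨fun p => Circle.exp (p.1 * h p.2) * g p.2,
      by fun_prop⟩, fun x => by simp, fun x => by simp [hx]⟩⟩

theorem hopf_theorem_for_graphs {V E : Type} [Fintype V] [Fintype E] (s t : E → V)
    (hconn : ConnectedSpace (GraphRealization s t)) :
    ∃ Φ : C(GraphRealization s t, Circle) →
          (Fin (Fintype.card E + 1 - Fintype.card V) → ℤ),
      Function.Surjective Φ ∧ ∀ f g, Φ f = Φ g ↔ f.Homotopic g := by
  have := GraphRealization.isTorsionFree_coker_coboundary (s := s) (t := t)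
  let b := (Module.finBasisOfFinrankEq ℤ _
    (GraphRealization.finrank_coker_coboundary (s := s) (t := t))).equivFun
  choose c hc using GraphRealization.exists_isWindingCochain (s := s) (t := t)
  have key : ∀ f g d, GraphRealization.IsWindingCochain g d →
      (b (Submodule.Quotient.mk (c f)) = b (Submodule.Quotient.mk d) ↔ f.Homotopic g) := by
    intro f g d hg
    rw [b.injective.eq_iff, Submodule.Quotient.eq, Circle.homotopic_iff_exists_lift_div,
      ((hc f).div hg).exists_lift_iff]
  refine ⟨fun f => b (Submodule.Quotient.mk (c f)), fun y => ?_, fun f g => key f g _ (hc g)⟩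
  obtain ⟨x, rfl⟩ := b.surjective y
  obtain ⟨d, rfl⟩ := Submodule.Quotient.mk_surjective _ x
  obtain ⟨f, hf⟩ := GraphRealization.exists_map_isWindingCochain (s := s) (t := t) d
  exact ⟨f, (key f f d hf).2 (.refl f)⟩
end

section
/- Borsuk–Ulam theorem: (a) no odd continuous map S¹ → S¹ is homotopic to a constant map; (b) there is no odd continuous map S² → S¹; (c) for every continuous map f : S² → ℝ² there exists a point x ∈ S² with f(x) = f(−x). -/
/-!
STATEMENT 12 (Borsuk–Ulam theorem):
(a) no odd continuous map S¹ → S¹ is homotopic to a constant map;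
(b) there is no odd continuous map S² → S¹;
(c) for every continuous map f : S² → ℝ² there exists x ∈ S² with f(x) = f(−x).

A map between spheres is odd (equivariant for the antipodal involutions) if
f(−x) = −f(x) for all x.
-/

open Metric

local notation "𝕊¹" => sphere (0 : EuclideanSpace ℝ (Fin 2)) 1
local notation "𝕊²" => sphere (0 : EuclideanSpace ℝ (Fin 3)) 1

/-- A circle-valued map that is odd for an involution of a nonempty preconnected space has no
continuous real-valued lift through `Circle.exp`. -/
lemma not_exists_lift_of_odd {X : Type*} [TopologicalSpace X] [PreconnectedSpace X] [Nonempty X]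
    {σ : X → X} (hσ : Continuous σ) (hinv : Function.Involutive σ) {g : X → ℝ}
    (hg : Continuous g)
    (hodd : ∀ x, (Circle.exp (g (σ x)) : ℂ) = -(Circle.exp (g x) : ℂ)) : False := by
  obtain ⟨x₀⟩ := ‹Nonempty X›
  have hcont : Continuous fun x ↦ g (σ x) - g x := (hg.comp hσ).sub hg
  obtain ⟨x, hx⟩ : ∃ x, g (σ x) - g x = 0 := by
    rcases le_total (g (σ x₀) - g x₀) 0 with h | h
    · exact mem_range_of_exists_le_of_exists_ge hcont ⟨x₀, h⟩
        ⟨σ x₀, by rw [hinv x₀]; linarith⟩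
    · exact mem_range_of_exists_le_of_exists_ge hcont
        ⟨σ x₀, by rw [hinv x₀]; linarith⟩ ⟨x₀, h⟩
  have hx' := hodd x
  rw [sub_eq_zero.mp hx, self_eq_neg] at hx'
  exact (Circle.exp (g x)).coe_ne_zero hx'

/-- The unit circle of the Euclidean plane, viewed in `ℂ`. -/
noncomputable def sphereToCircle : C(𝕊¹, Circle) where
  toFun x := ⟨Complex.orthonormalBasisOneI.repr.symm x,
    mem_sphere_zero_iff_norm.mpr <|
      (Complex.orthonormalBasisOneI.repr.symm.norm_map _).trans (norm_eq_of_mem_sphere x)⟩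
  continuous_toFun := by
    refine Continuous.subtype_mk ?_ _
    exact Complex.orthonormalBasisOneI.repr.symm.continuous.comp continuous_subtype_val

lemma sphereToCircle_neg (x : 𝕊¹) :
    (sphereToCircle (-x) : ℂ) = -(sphereToCircle x : ℂ) :=
  map_neg Complex.orthonormalBasisOneI.repr.symm (x : EuclideanSpace ℝ (Fin 2))

lemma not_homotopic_const_of_odd (f : C(𝕊¹, 𝕊¹)) (hf : ∀ x, f (-x) = -f x) (y : 𝕊¹) :
    ¬f.Homotopic (ContinuousMap.const _ y) := by
  rintro ⟨H⟩
  have hpre : IsPreconnected (𝕊¹) := isPreconnected_sphere (by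
    rw [← Module.finrank_eq_rank, finrank_euclideanSpace_fin]; norm_num) 0 1
  have : PreconnectedSpace 𝕊¹ := isPreconnected_iff_preconnectedSpace.mp hpre
  have : Nonempty 𝕊¹ := ⟨y⟩
  obtain ⟨t, ht⟩ := Circle.exp_surjective (sphereToCircle y)
  let K : C(unitInterval × 𝕊¹, Circle) := sphereToCircle.comp H.symm.toContinuousMap
  have hK : ∀ a, K (0, a) = Circle.exp (ContinuousMap.const 𝕊¹ t a) := fun a ↦ by
    simp [K, ht]
  let G := Circle.isCoveringMap_exp.liftHomotopy K (ContinuousMap.const _ t) hK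
  have hG : ∀ x, Circle.exp (G (1, x)) = sphereToCircle (f x) := fun x ↦ by
    have hlift : Circle.exp (G (1, x)) = K (1, x) :=
      congrFun (Circle.isCoveringMap_exp.liftHomotopy_lifts K _ hK) (1, x)
    rw [hlift]
    simp [K]
  refine not_exists_lift_of_odd (X := 𝕊¹) (σ := Neg.neg) continuous_neg neg_involutive
    (g := fun x ↦ G (1, x)) (by fun_prop) fun x ↦ ?_
  rw [hG, hG, hf, sphereToCircle_neg]

/-- The point of `𝕊²` at latitude `s` over the point `x` of the equator. -/
noncomputable def latitude : C(ℝ × 𝕊¹, 𝕊²) where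
  toFun p := ⟨!₂[Real.cos p.1 * p.2.1 0, Real.cos p.1 * p.2.1 1, Real.sin p.1], by
    obtain ⟨s, x, hx⟩ := p
    rw [mem_sphere_zero_iff_norm, EuclideanSpace.norm_eq, Real.sqrt_eq_one] at hx ⊢
    simp only [Fin.sum_univ_succ, Fin.sum_univ_zero, Real.norm_eq_abs, sq_abs] at hx ⊢
    simp at hx ⊢
    linear_combination Real.cos s ^ 2 * hx + Real.sin_sq_add_cos_sq s⟩
  continuous_toFun := by
    refine Continuous.subtype_mk ?_ _
    refine (PiLp.continuous_toLp 2 _).comp (continuous_pi fun i ↦ ?_)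
    fin_cases i <;> simp <;> fun_prop

lemma latitude_zero_neg (x : 𝕊¹) : latitude (0, -x) = -latitude (0, x) := by
  ext i
  fin_cases i <;> simp [latitude]

lemma latitude_pi_div_two (x y : 𝕊¹) :
    latitude (Real.pi / 2, x) = latitude (Real.pi / 2, y) := by
  ext i
  fin_cases i <;> simp [latitude]

lemma not_odd_sphere_two_to_sphere_one (f : C(𝕊², 𝕊¹)) : ¬∀ x, f (-x) = -f x := by
  intro hf
  let e : 𝕊¹ := ⟨EuclideanSpace.single 0 1, by simp⟩
  let q : C(𝕊¹, 𝕊¹) := ⟨fun x ↦ f (latitude (0, x)), by fun_prop⟩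
  refine not_homotopic_const_of_odd q (fun x ↦ ?_) (f (latitude (Real.pi / 2, e))) ⟨?_⟩
  · simp [q, latitude_zero_neg, hf]
  · exact
      { toFun p := f (latitude (p.1 * (Real.pi / 2), p.2))
        continuous_toFun := by fun_prop
        map_zero_left x := by simp [q]
        map_one_left x := by simp [latitude_pi_div_two x e] }

lemma exists_eq_neg_sphere_two (f : C(𝕊², EuclideanSpace ℝ (Fin 2))) :
    ∃ x, f x = f (-x) := by
  by_contra! hne
  have hd : ∀ x, ‖f x - f (-x)‖ ≠ 0 := fun x ↦ norm_ne_zero_iff.mpr (sub_ne_zero.mpr (hne x))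
  let g : C(𝕊², 𝕊¹) :=
    { toFun x := ⟨‖f x - f (-x)‖⁻¹ • (f x - f (-x)), by
        simp [norm_smul, inv_mul_cancel₀ (hd x)]⟩
      continuous_toFun := by
        refine Continuous.subtype_mk ?_ _
        have hc : Continuous fun x ↦ f x - f (-x) := by fun_prop
        exact (hc.norm.inv₀ hd).smul hc }
  refine not_odd_sphere_two_to_sphere_one g fun x ↦ Subtype.ext ?_
  change ‖f (-x) - f (- -x)‖⁻¹ • (f (-x) - f (- -x)) = -(‖f x - f (-x)‖⁻¹ • (f x - f (-x)))
  rw [neg_neg, norm_sub_rev, ← smul_neg, neg_sub]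

theorem borsuk_ulam :
    (∀ f : C(𝕊¹, 𝕊¹), (∀ x, f (-x) = -f x) →
      ∀ y : 𝕊¹, ¬f.Homotopic (ContinuousMap.const _ y)) ∧
    (∀ f : C(𝕊², 𝕊¹), ¬(∀ x, f (-x) = -f x)) ∧
    (∀ f : C(𝕊², EuclideanSpace ℝ (Fin 2)), ∃ x, f x = f (-x)) :=
  ⟨not_homotopic_const_of_odd, not_odd_sphere_two_to_sphere_one, exists_eq_neg_sphere_two⟩
end

section
/- Moore's theorem on triods: the plane ℝ² does not contain an uncountable family of pairwise disjoint triods, i.e. every family of pairwise disjoint subsets of ℝ², each homeomorphic to the triod, is countable. -/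
/-!
STATEMENT 13 (Moore's theorem on triods): the plane ℝ² does not contain an
uncountable family of pairwise disjoint triods, i.e. every family of pairwise
disjoint subsets of ℝ², each homeomorphic to the triod, is countable.

A triod is a space homeomorphic to the union of three segments having exactly
one common point which is an endpoint of each of them (the letter T); below we
use the concrete standard triod in the plane.
-/

/-- The standard triod: three segments in the plane with a single common endpoint. -/
def stdTriod : Set (ℝ × ℝ) :=
  segment ℝ (0, 0) (1, 0) ∪ segment ℝ (0, 0) (-1, 0) ∪ segment ℝ (0, 0) (0, 1)

/-- A nowhere vanishing continuous function on a contractible space has a continuous logarithm. -/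
theorem ContinuousMap.exists_exp_eq_of_contractibleSpace {X : Type*} [TopologicalSpace X]
    [ContractibleSpace X] (f : C(X, ℂ)) (hf : ∀ x, f x ≠ 0) :
    ∃ g : C(X, ℂ), ∀ x, Complex.exp (g x) = f x := by
  obtain ⟨y, ⟨F⟩⟩ := id_nullhomotopic X
  let H : C(unitInterval × X, {z : ℂ // z ≠ 0}) :=
    ⟨fun p => ⟨f (F.symm p), hf _⟩, by fun_prop⟩
  have H_zero (x : X) : H (0, x) = ⟨_, (Complex.log (f y)).exp_ne_zero⟩ := by
    ext
    simp [H, Complex.exp_log (hf y)]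
  let L := Complex.isCoveringMap_exp.liftHomotopy H (.const X (Complex.log (f y))) H_zero
  refine ⟨⟨fun x => L (1, x), by fun_prop⟩, fun x => ?_⟩
  have h := congrArg Subtype.val
    (congrFun (Complex.isCoveringMap_exp.liftHomotopy_lifts H (.const X _) H_zero) (1, x))
  exact h.trans (by simp [H])

/-- Suppose that in the square of a compact contractible space `X` some pair `(a, b)` of points can
be connected to `(b, a)` off the diagonal. Then the image of an embedding of `X` in the plane meets
the image of every map that is close enough to the embedding. -/
theorem exists_forall_dist_lt_exists_eq {X : Type*} [TopologicalSpace X] [CompactSpace X]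
    [ContractibleSpace X] {K : Set (X × X)} (hK : IsCompact K) (hKc : IsPreconnected K)
    (hKd : ∀ p ∈ K, p.1 ≠ p.2) {a b : X} (hab : (a, b) ∈ K) (hba : (b, a) ∈ K)
    (φ : C(X, ℂ)) (hφ : Function.Injective φ) :
    ∃ ε > 0, ∀ ψ : C(X, ℂ), dist φ ψ < ε → ∃ s t, φ s = ψ t := by
  obtain ⟨p₀, hp₀, hmin⟩ := hK.exists_isMinOn ⟨_, hab⟩
    (f := fun p : X × X => ‖φ p.1 - φ p.2‖) (by fun_prop)
  have hδ : 0 < ‖φ p₀.1 - φ p₀.2‖ := norm_pos_iff.2 (sub_ne_zero.2 (hφ.ne (hKd _ hp₀)))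
  refine ⟨‖φ p₀.1 - φ p₀.2‖ / 3, by positivity, fun ψ hψ => ?_⟩
  by_contra! hne
  obtain ⟨g, hg⟩ := ContinuousMap.exists_exp_eq_of_contractibleSpace
    (⟨fun p => φ p.1 - ψ p.2, by fun_prop⟩ : C(X × X, ℂ)) (fun p => sub_ne_zero.2 (hne _ _))
  simp only [ContinuousMap.coe_mk] at hg
  have him (p : X × X) (hp : p ∈ K) : (g p.swap - g p).im ≠ 0 := by
    intro h0
    have hexp : φ p.2 - ψ p.1 = (Real.exp (g p.swap - g p).re : ℂ) * (φ p.1 - ψ p.2) := by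
      have hre : ((g p.swap - g p).re : ℂ) = g p.swap - g p := Complex.ext rfl (by simp [h0])
      rw [Complex.ofReal_exp, hre, Complex.exp_sub, hg, hg]
      exact (div_mul_cancel₀ _ (sub_ne_zero.2 (hne _ _))).symm
    have hmul : ‖(φ p.1 - ψ p.2) + (φ p.2 - ψ p.1)‖ =
        (1 + Real.exp (g p.swap - g p).re) * ‖φ p.1 - ψ p.2‖ := by
      rw [hexp, ← one_add_mul, norm_mul, ← Complex.ofReal_one, ← Complex.ofReal_add,
        Complex.norm_real, Real.norm_of_nonneg (by positivity)]
    have h₁ : ‖φ p.1 - ψ p.1‖ < ‖φ p₀.1 - φ p₀.2‖ / 3 := by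
      simpa [dist_eq_norm] using (ContinuousMap.dist_apply_le_dist p.1).trans_lt hψ
    have h₂ : ‖φ p.2 - ψ p.2‖ < ‖φ p₀.1 - φ p₀.2‖ / 3 := by
      simpa [dist_eq_norm] using (ContinuousMap.dist_apply_le_dist p.2).trans_lt hψ
    have hsum : ‖(φ p.1 - ψ p.2) + (φ p.2 - ψ p.1)‖ ≤ ‖φ p.1 - ψ p.1‖ + ‖φ p.2 - ψ p.2‖ := by
      rw [show (φ p.1 - ψ p.2) + (φ p.2 - ψ p.1) = (φ p.1 - ψ p.1) + (φ p.2 - ψ p.2) by ring]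
      exact norm_add_le _ _
    have hfar : ‖φ p.1 - φ p.2‖ ≤ ‖φ p.1 - ψ p.2‖ + ‖φ p.2 - ψ p.2‖ := by
      rw [show φ p.1 - φ p.2 = (φ p.1 - ψ p.2) - (φ p.2 - ψ p.2) by ring]
      exact norm_sub_le _ _
    have hge : ‖φ p₀.1 - φ p₀.2‖ ≤ ‖φ p.1 - φ p.2‖ := hmin hp
    nlinarith [Real.exp_pos (g p.swap - g p).re, norm_nonneg (φ p.1 - ψ p.2)]
  have hpre := hKc.image (fun p : X × X => (g p.swap - g p).im)
    (Complex.continuous_im.comp (by fun_prop)).continuousOn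
  have hzero : (0 : ℝ) ∈ (fun p : X × X => (g p.swap - g p).im) '' K := by
    rcases le_total 0 (g (b, a) - g (a, b)).im with h | h
    · refine hpre.Icc_subset ⟨_, hba, rfl⟩ ⟨_, hab, rfl⟩ ⟨?_, by simpa using h⟩
      simpa using h
    · refine hpre.Icc_subset ⟨_, hab, rfl⟩ ⟨_, hba, rfl⟩ ⟨by simpa using h, ?_⟩
      simpa using h
  obtain ⟨p, hp, h0⟩ := hzero
  exact him p hp h0

theorem isCompact_segment (x y : ℝ × ℝ) : IsCompact (segment ℝ x y) := by
  rw [segment_eq_image]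
  exact isCompact_Icc.image (by fun_prop)

theorem isCompact_stdTriod : IsCompact stdTriod :=
  ((isCompact_segment _ _).union (isCompact_segment _ _)).union (isCompact_segment _ _)

instance : CompactSpace stdTriod := isCompact_iff_compactSpace.1 isCompact_stdTriod

instance : ContractibleSpace stdTriod := by
  have hstar (x : ℝ × ℝ) : StarConvex ℝ (0, 0) (segment ℝ (0, 0) x) :=
    (convex_segment _ _).starConvex (left_mem_segment ..)
  exact (((hstar _).union (hstar _)).union (hstar _)).contractibleSpace
    ⟨(0, 0), .inl (.inl (left_mem_segment ..))⟩

/-- The part of the standard triod that lies on the two segments from the origin to `x` and `y`. -/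
def stdTriodArc (x y : ℝ × ℝ) : Set stdTriod :=
  Subtype.val ⁻¹' (segment ℝ (0, 0) x ∪ segment ℝ (0, 0) y)

theorem isCompact_stdTriodArc (x y : ℝ × ℝ) : IsCompact (stdTriodArc x y) :=
  (((isCompact_segment _ _).union (isCompact_segment _ _)).isClosed.preimage
    continuous_subtype_val).isCompact

theorem isPreconnected_stdTriodArc {x y : ℝ × ℝ} (hx : segment ℝ (0, 0) x ⊆ stdTriod)
    (hy : segment ℝ (0, 0) y ⊆ stdTriod) : IsPreconnected (stdTriodArc x y) := by
  rw [← Topology.IsInducing.subtypeVal.isPreconnected_image, stdTriodArc,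
    Subtype.image_preimage_coe, Set.inter_eq_right.2 (Set.union_subset hx hy)]
  exact (convex_segment _ _).isPreconnected.union (0, 0) (left_mem_segment ..)
    (left_mem_segment ..) (convex_segment _ _).isPreconnected

/-- Two endpoints of the standard triod can be interchanged by moving them continuously along the
triod without letting them meet. -/
theorem exists_isPreconnected_swap_mem_stdTriod :
    ∃ K : Set (stdTriod × stdTriod), IsCompact K ∧ IsPreconnected K ∧ (∀ p ∈ K, p.1 ≠ p.2) ∧
      ∃ a b, (a, b) ∈ K ∧ (b, a) ∈ K := by
  have hright : segment ℝ (0, 0) (1, 0) ⊆ stdTriod := fun _ h => .inl (.inl h)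
  have hleft : segment ℝ (0, 0) (-1, 0) ⊆ stdTriod := fun _ h => .inl (.inr h)
  have htop : segment ℝ (0, 0) (0, 1) ⊆ stdTriod := fun _ h => .inr h
  let r : stdTriod := ⟨(1, 0), hright (right_mem_segment ..)⟩
  let l : stdTriod := ⟨(-1, 0), hleft (right_mem_segment ..)⟩
  let t : stdTriod := ⟨(0, 1), htop (right_mem_segment ..)⟩
  have hr : r ∉ stdTriodArc (-1, 0) (0, 1) := by
    rintro (h | h) <;> obtain ⟨u, v, hu, hv, -, h⟩ := h <;>
      simp [r] at h <;> linarith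
  have hl : l ∉ stdTriodArc (0, 1) (1, 0) := by
    rintro (h | h) <;> obtain ⟨u, v, hu, hv, -, h⟩ := h <;>
      simp [l] at h <;> linarith
  have ht : t ∉ stdTriodArc (1, 0) (-1, 0) := by
    rintro (h | h) <;> obtain ⟨u, v, hu, hv, -, h⟩ := h <;> simp [t] at h
  refine ⟨{r} ×ˢ stdTriodArc (-1, 0) (0, 1) ∪ stdTriodArc (1, 0) (-1, 0) ×ˢ {t} ∪
    {l} ×ˢ stdTriodArc (0, 1) (1, 0), ?_, ?_, ?_, r, l, ?_, ?_⟩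
  · exact ((isCompact_singleton.prod (isCompact_stdTriodArc _ _)).union
      ((isCompact_stdTriodArc _ _).prod isCompact_singleton)).union
      (isCompact_singleton.prod (isCompact_stdTriodArc _ _))
  · refine IsPreconnected.union (l, t) (.inr ⟨.inr (right_mem_segment ..), rfl⟩)
      ⟨rfl, .inl (right_mem_segment ..)⟩ ?_
      (isPreconnected_singleton.prod (isPreconnected_stdTriodArc htop hright))
    exact IsPreconnected.union (r, t) ⟨rfl, .inr (right_mem_segment ..)⟩
      ⟨.inl (right_mem_segment ..), rfl⟩
      (isPreconnected_singleton.prod (isPreconnected_stdTriodArc hleft htop))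
      ((isPreconnected_stdTriodArc hright hleft).prod isPreconnected_singleton)
  · rintro ⟨p, q⟩ hpq (rfl : p = q)
    rcases hpq with (⟨rfl, h⟩ | ⟨h, rfl⟩) | ⟨rfl, h⟩
    exacts [hr h, ht h, hl h]
  · exact .inl (.inl ⟨rfl, .inl (right_mem_segment ..)⟩)
  · exact .inr ⟨rfl, .inr (right_mem_segment ..)⟩

theorem moore_triods (𝒜 : Set (Set (ℝ × ℝ)))
    (htriod : ∀ A ∈ 𝒜, Nonempty (A ≃ₜ stdTriod))
    (hdisj : 𝒜.Pairwise fun A B => Disjoint A B) :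
    𝒜.Countable := by
  obtain ⟨K, hK, hKc, hKd, a, b, hab, hba⟩ := exists_isPreconnected_swap_mem_stdTriod
  have e (A : 𝒜) : A.1 ≃ₜ stdTriod := (htriod A A.2).some
  let c : ℝ × ℝ ≃ₜ ℂ := Complex.equivRealProdCLM.symm.toHomeomorph
  let Φ (A : 𝒜) : C(stdTriod, ℂ) := ⟨fun s => c ((e A).symm s), by fun_prop⟩
  have hΦ (A : 𝒜) : Function.Injective (Φ A) :=
    c.injective.comp (Subtype.val_injective.comp (e A).symm.injective)
  have hmeet (A B : 𝒜) (h : ∃ s t, Φ A s = Φ B t) : A = B := by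
    obtain ⟨s, t, hst⟩ := h
    by_contra hAB
    refine Set.disjoint_left.1 (hdisj A.2 B.2 (Subtype.val_injective.ne hAB))
      ((e A).symm s).2 ?_
    rw [c.injective hst]
    exact ((e B).symm t).2
  have hinj : Function.Injective Φ := fun A B h => hmeet A B ⟨a, a, by rw [h]⟩
  have hdiscrete : IsDiscrete (Set.range Φ) := by
    rw [isDiscrete_iff_forall_mem_exists_isOpen]
    rintro _ ⟨A, rfl⟩
    obtain ⟨ε, hε, h⟩ := exists_forall_dist_lt_exists_eq hK hKc hKd hab hba (Φ A) (hΦ A)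
    refine ⟨Metric.ball (Φ A) ε, Metric.isOpen_ball, ?_⟩
    ext ψ
    constructor
    · rintro ⟨hψ, B, rfl⟩
      rw [hmeet A B (h _ (by simpa [dist_comm] using hψ))]
      rfl
    · rintro rfl
      exact ⟨Metric.mem_ball_self hε, A, rfl⟩
  have hcount : (Set.range Φ).Countable :=
    (HereditarilyLindelofSpace.isLindelof _).countable_of_isDiscrete hdiscrete
  have := hcount.to_subtype
  exact Set.countable_coe_iff.1 (Set.rangeFactorization_injective.2 hinj).countable
end

section
/- The 3-adic solenoid Σ₃ admits no topological embedding into the plane ℝ², yet there exists a continuous equivariant map Φ : Σ̃₃ → S¹, i.e. a continuous map on the deleted square Σ̃₃ = {(x,y) ∈ Σ₃ × Σ₃ : x ≠ y} satisfying Φ(y,x) = −Φ(x,y) for all (x,y) ∈ Σ̃₃. -/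
/-!
STATEMENT 15: the 3-adic solenoid Σ₃ admits no topological embedding into the
plane ℝ², yet there exists a continuous equivariant map Φ : Σ̃₃ → S¹ on the
deleted square Σ̃₃ = {(x,y) ∈ Σ₃ × Σ₃ : x ≠ y}, i.e. satisfying
Φ(y,x) = −Φ(x,y) for all (x,y) ∈ Σ̃₃.
-/

/-- The 3-adic solenoid: sequences of points of the circle, each being the cube of
the next, with the product (Tychonoff) topology. -/
abbrev Solenoid3 : Type := {x : ℕ → Circle // ∀ i, x (i + 1) ^ 3 = x i}

/-- The deleted square of the 3-adic solenoid. -/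
abbrev Solenoid3DeletedSquare : Type := {p : Solenoid3 × Solenoid3 // p.1 ≠ p.2}

/-! ### The equivariant map on the deleted square -/

/-- A continuous map `ℝ → S¹` equal to `1` on `[ε, ∞)` and to `-1` on `(-∞, -ε]`. -/
noncomputable def signPhase (ε r : ℝ) : Circle :=
  Circle.exp (Real.pi * max 0 (min 1 ((1 - r / ε) / 2)))

lemma continuous_signPhase (ε : ℝ) : Continuous (signPhase ε) := by
  unfold signPhase
  fun_prop

lemma signPhase_mul_abs {ε r : ℝ} (hε : 0 < ε) (h : ε ≤ |r|) :
    (signPhase ε r : ℂ) * (|r| : ℝ) = r := by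
  rcases le_total 0 r with hr | hr
  · rw [abs_of_nonneg hr] at h ⊢
    have h1 : 1 ≤ r / ε := by rwa [one_le_div hε]
    have h2 : max 0 (min 1 ((1 - r / ε) / 2)) = 0 :=
      max_eq_left ((min_le_right _ _).trans (by linarith))
    simp [signPhase, h2]
  · rw [abs_of_nonpos hr] at h ⊢
    have h1 : 1 ≤ -r / ε := by rwa [one_le_div hε]
    rw [neg_div] at h1
    have h2 : max 0 (min 1 ((1 - r / ε) / 2)) = 1 := by
      rw [min_eq_left (by linarith), max_eq_right zero_le_one]
    simp [signPhase, h2]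

/-- Points of the unit circle satisfy `a³ - b³ = (a - b) · ab · (1 + 2 Re (a / b))`. -/
lemma Circle.cube_sub_cube (a b : Circle) :
    (a : ℂ) ^ 3 - (b : ℂ) ^ 3 =
      (a - b) * (a * b) * ((1 + 2 * ((a / b : Circle) : ℂ).re : ℝ) : ℂ) := by
  have ha : (a : ℂ) ≠ 0 := Circle.coe_ne_zero a
  have hb : (b : ℂ) ≠ 0 := Circle.coe_ne_zero b
  have h : (2 * (((a / b : Circle) : ℂ).re : ℝ) : ℂ) = a / b + b / a := by
    have h1 := Complex.add_conj ((a / b : Circle) : ℂ)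
    rw [← Circle.coe_inv_eq_conj, inv_div, Circle.coe_div, Circle.coe_div] at h1
    rw [h1, Circle.coe_div]
    push_cast
    rfl
  push_cast at h ⊢
  rw [h]
  field_simp
  ring

namespace Solenoid3

/-- The unit vector pointing from `y n` to `x n`. -/
noncomputable def direction (n : ℕ) (p : Solenoid3 × Solenoid3) : ℂ :=
  ((p.1.1 n : ℂ) - p.2.1 n) / (‖(p.1.1 n : ℂ) - p.2.1 n‖ : ℝ)

/-- Symmetric factors making the successive directions agree. -/
noncomputable def phase : ℕ → Solenoid3 × Solenoid3 → Circle
  | 0, _ => 1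
  | n + 1, p => (p.1.1 (n + 1) * p.2.1 (n + 1)) *
      signPhase ((1 / 4) ^ (n + 1)) (1 + 2 * ((p.1.1 (n + 1) / p.2.1 (n + 1) : Circle) : ℂ).re) *
      phase n p

lemma continuous_coord (n : ℕ) : Continuous fun x : Solenoid3 => x.1 n :=
  (continuous_apply n).comp continuous_subtype_val

lemma continuous_phase (n : ℕ) : Continuous (phase n) := by
  induction n with
  | zero => exact continuous_const
  | succ n ih =>
    have h1 : Continuous fun p : Solenoid3 × Solenoid3 => p.1.1 (n + 1) :=
      (continuous_coord (n + 1)).comp continuous_fst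
    have h2 : Continuous fun p : Solenoid3 × Solenoid3 => p.2.1 (n + 1) :=
      (continuous_coord (n + 1)).comp continuous_snd
    refine ((h1.mul h2).mul ((continuous_signPhase _).comp ?_)).mul ih
    exact continuous_const.add (continuous_const.mul
      (Complex.continuous_re.comp (continuous_subtype_val.comp (h1.div' h2))))

lemma phase_swap (n : ℕ) (p : Solenoid3 × Solenoid3) : phase n p.swap = phase n p := by
  induction n with
  | zero => rfl
  | succ n ih =>
    have h : ((p.2.1 (n + 1) / p.1.1 (n + 1) : Circle) : ℂ).re =
        ((p.1.1 (n + 1) / p.2.1 (n + 1) : Circle) : ℂ).re := by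
      rw [← inv_div, Circle.coe_inv_eq_conj, Complex.conj_re]
    simp only [phase, ih, Prod.fst_swap, Prod.snd_swap, h, mul_comm (p.2.1 (n + 1))]

lemma direction_swap (n : ℕ) (p : Solenoid3 × Solenoid3) :
    direction n p.swap = -direction n p := by
  simp only [direction, Prod.fst_swap, Prod.snd_swap]
  rw [norm_sub_rev, ← neg_sub, neg_div]

/-- The pairs whose `n`-th coordinates are more than `4⁻ⁿ` apart. -/
def separated (n : ℕ) : Set (Solenoid3 × Solenoid3) :=
  {p | (1 / 4 : ℝ) ^ n < ‖(p.1.1 n : ℂ) - p.2.1 n‖}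

lemma continuous_coord_sub (n : ℕ) :
    Continuous fun p : Solenoid3 × Solenoid3 => (p.1.1 n : ℂ) - p.2.1 n :=
  (continuous_subtype_val.comp ((continuous_coord n).comp continuous_fst)).sub
    (continuous_subtype_val.comp ((continuous_coord n).comp continuous_snd))

lemma isOpen_separated (n : ℕ) : IsOpen (separated n) :=
  isOpen_lt continuous_const (continuous_coord_sub n).norm

lemma coord_sub_eq (n : ℕ) (p : Solenoid3 × Solenoid3) :
    (p.1.1 n : ℂ) - p.2.1 n = ((p.1.1 (n + 1) : ℂ) - p.2.1 (n + 1)) *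
      (p.1.1 (n + 1) * p.2.1 (n + 1)) *
        ((1 + 2 * ((p.1.1 (n + 1) / p.2.1 (n + 1) : Circle) : ℂ).re : ℝ) : ℂ) := by
  rw [← Circle.cube_sub_cube, ← p.1.2 n, ← p.2.2 n]
  simp

lemma norm_coord_sub_eq (n : ℕ) (p : Solenoid3 × Solenoid3) :
    ‖(p.1.1 n : ℂ) - p.2.1 n‖ = ‖(p.1.1 (n + 1) : ℂ) - p.2.1 (n + 1)‖ *
      |1 + 2 * ((p.1.1 (n + 1) / p.2.1 (n + 1) : Circle) : ℂ).re| := by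
  rw [coord_sub_eq n p, norm_mul, norm_mul, norm_mul, Circle.norm_coe, Circle.norm_coe,
    Complex.norm_real, Real.norm_eq_abs]
  ring

lemma norm_coord_sub_le (n : ℕ) (p : Solenoid3 × Solenoid3) :
    ‖(p.1.1 n : ℂ) - p.2.1 n‖ ≤ 3 * ‖(p.1.1 (n + 1) : ℂ) - p.2.1 (n + 1)‖ := by
  rw [norm_coord_sub_eq n p, mul_comm]
  have h := Complex.abs_re_le_norm ((p.1.1 (n + 1) / p.2.1 (n + 1) : Circle) : ℂ)
  rw [Circle.norm_coe, abs_le] at h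
  exact mul_le_mul_of_nonneg_right (abs_le.2 ⟨by linarith, by linarith⟩) (norm_nonneg _)

lemma separated_subset_succ (n : ℕ) : separated n ⊆ separated (n + 1) := by
  intro p hp
  have h := norm_coord_sub_le n p
  have h4 : (0 : ℝ) < (1 / 4) ^ n := by positivity
  simp only [separated, Set.mem_ofPred_eq] at hp ⊢
  rw [pow_succ]
  linarith

lemma exists_mem_separated {p : Solenoid3 × Solenoid3} (hp : p.1 ≠ p.2) :
    ∃ n, p ∈ separated n := by
  obtain ⟨m, hm⟩ : ∃ m, p.1.1 m ≠ p.2.1 m := by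
    by_contra! h
    exact hp (Subtype.ext (funext h))
  set δ := ‖(p.1.1 m : ℂ) - p.2.1 m‖
  have hδ : 0 < δ := norm_pos_iff.2 (sub_ne_zero.2 fun h => hm (Circle.ext h))
  have hk : ∀ k, (1 / 3 : ℝ) ^ k * δ ≤ ‖(p.1.1 (m + k) : ℂ) - p.2.1 (m + k)‖ := by
    intro k
    induction k with
    | zero => simp [δ]
    | succ k ih =>
      have := norm_coord_sub_le (m + k) p
      rw [← add_assoc, pow_succ]
      linarith
  obtain ⟨k, hlt⟩ := exists_pow_lt_of_lt_one hδ (show (3 / 4 : ℝ) < 1 by norm_num)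
  refine ⟨m + k, lt_of_lt_of_le ?_ (hk k)⟩
  calc (1 / 4 : ℝ) ^ (m + k) ≤ (1 / 4) ^ k :=
        pow_le_pow_of_le_one (by norm_num) (by norm_num) (by omega)
    _ = (1 / 3) ^ k * (3 / 4) ^ k := by rw [← mul_pow]; norm_num
    _ < (1 / 3) ^ k * δ := mul_lt_mul_of_pos_left hlt (by positivity)

lemma coord_sub_ne_zero {n : ℕ} {p : Solenoid3 × Solenoid3} (hp : p ∈ separated n) :
    (p.1.1 n : ℂ) - p.2.1 n ≠ 0 :=
  norm_pos_iff.1 ((by positivity : (0 : ℝ) < (1 / 4) ^ n).trans hp)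

lemma direction_mul_phase_succ {n : ℕ} {p : Solenoid3 × Solenoid3} (hp : p ∈ separated n) :
    direction (n + 1) p * phase (n + 1) p = direction n p * phase n p := by
  have h0 := coord_sub_ne_zero hp
  have hnorm := norm_coord_sub_eq n p
  have hsub := coord_sub_eq n p
  have hlt : (1 / 4 : ℝ) ^ n < ‖(p.1.1 n : ℂ) - p.2.1 n‖ := hp
  have h2 : ‖(p.1.1 (n + 1) : ℂ) - p.2.1 (n + 1)‖ ≤ 2 := by
    refine (norm_sub_le _ _).trans ?_
    rw [Circle.norm_coe, Circle.norm_coe]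
    norm_num
  simp only [direction, phase, Circle.coe_mul]
  set r := 1 + 2 * ((p.1.1 (n + 1) / p.2.1 (n + 1) : Circle) : ℂ).re
  have hr : (1 / 4 : ℝ) ^ (n + 1) ≤ |r| := by
    have := mul_le_mul_of_nonneg_right h2 (abs_nonneg r)
    have h4 : (0 : ℝ) < (1 / 4) ^ n := by positivity
    rw [pow_succ]
    linarith
  have hsign := signPhase_mul_abs (by positivity) hr
  rw [hsub] at h0
  rw [hnorm, hsub, ← hsign]
  have hd : ((‖(p.1.1 (n + 1) : ℂ) - p.2.1 (n + 1)‖ : ℝ) : ℂ) ≠ 0 := by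
    rw [Complex.ofReal_ne_zero, norm_ne_zero_iff]
    exact left_ne_zero_of_mul (left_ne_zero_of_mul h0)
  have hr0 : ((|r| : ℝ) : ℂ) ≠ 0 := by
    rw [Complex.ofReal_ne_zero]
    exact (lt_of_lt_of_le (by positivity) hr).ne'
  rw [Complex.ofReal_mul]
  field_simp

lemma direction_mul_phase_eq {m n : ℕ} {p : Solenoid3 × Solenoid3} (hp : p ∈ separated m)
    (hmn : m ≤ n) : direction n p * phase n p = direction m p * phase m p := by
  induction n, hmn using Nat.le_induction with
  | base => rfl
  | succ n hmn ih =>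
    rw [direction_mul_phase_succ (monotone_nat_of_le_succ separated_subset_succ hmn hp), ih]

theorem exists_equivariant_map :
    ∃ Φ : Solenoid3DeletedSquare → Circle,
      Continuous Φ ∧
      ∀ (x y : Solenoid3) (h : x ≠ y),
        (Φ ⟨(y, x), Ne.symm h⟩ : ℂ) = -(Φ ⟨(x, y), h⟩ : ℂ) := by
  choose N hN using fun p : Solenoid3DeletedSquare => exists_mem_separated p.2
  let Ψ : Solenoid3DeletedSquare → ℂ := fun p => direction (N p) p.1 * phase (N p) p.1
  have hΨ : ∀ (p : Solenoid3DeletedSquare) (n : ℕ), p.1 ∈ separated n →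
      Ψ p = direction n p.1 * phase n p.1 := by
    intro p n hn
    rcases le_total n (N p) with h | h
    · exact direction_mul_phase_eq hn h
    · exact (direction_mul_phase_eq (hN p) h).symm
  have hnorm : ∀ p, ‖Ψ p‖ = 1 := by
    intro p
    have h0 := coord_sub_ne_zero (hN p)
    simp only [Ψ, direction, norm_mul, norm_div, Circle.norm_coe, Complex.norm_real, norm_norm]
    rw [div_self (norm_ne_zero_iff.2 h0), mul_one]
  have hcont : Continuous Ψ := by
    rw [continuous_iff_continuousAt]
    intro p
    have hnhds : Subtype.val ⁻¹' separated (N p) ∈ nhds p :=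
      ((isOpen_separated (N p)).preimage continuous_subtype_val).mem_nhds (hN p)
    have hev : (fun q : Solenoid3DeletedSquare => direction (N p) q.1 * phase (N p) q.1)
        =ᶠ[nhds p] Ψ := by
      filter_upwards [hnhds] with q hq using (hΨ q _ hq).symm
    refine ContinuousAt.congr ?_ hev
    have hsub := ((continuous_coord_sub (N p)).comp
      (continuous_subtype_val (p := fun q : Solenoid3 × Solenoid3 => q.1 ≠ q.2))).continuousAt
        (x := p)
    refine ContinuousAt.mul (hsub.div (Complex.continuous_ofReal.continuousAt.comp hsub.norm) ?_) ?_
    · exact Complex.ofReal_ne_zero.2 (norm_ne_zero_iff.2 (coord_sub_ne_zero (hN p)))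
    · exact (continuous_subtype_val.comp
        ((continuous_phase (N p)).comp continuous_subtype_val)).continuousAt
  have hmem : ∀ p, Ψ p ∈ Submonoid.unitSphere ℂ := fun p => by
    simpa [Submonoid.unitSphere] using hnorm p
  refine ⟨fun p => ⟨Ψ p, hmem p⟩, hcont.subtype_mk hmem, fun x y h => ?_⟩
  change Ψ ⟨(y, x), _⟩ = -Ψ ⟨(x, y), h⟩
  have hs : (y, x) ∈ separated (N ⟨(x, y), h⟩) := by
    have := hN ⟨(x, y), h⟩
    simp only [separated, Set.mem_ofPred_eq] at this ⊢
    rwa [norm_sub_rev]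
  rw [hΨ ⟨(y, x), _⟩ _ hs, ← neg_mul, ← direction_swap, ← phase_swap]
  rfl

end Solenoid3

/-! ### Nonvanishing functions modulo exponentials -/

section PlanarCompacta

open Set Filter Topology Complex

lemma exists_continuousOn_exp_eq {S : Set ℂ} (hS : Convex ℝ S) (hne : S.Nonempty)
    (ho : IsOpen S) {F : ℂ → ℂ} (hF : ContinuousOn F S) (h0 : ∀ z ∈ S, F z ≠ 0) :
    ∃ L : ℂ → ℂ, ContinuousOn L S ∧ ∀ z ∈ S, exp (L z) = F z := by
  have := hS.contractibleSpace hne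
  have hsc : IsSimplyConnected S := (inferInstance : SimplyConnectedSpace S)
  refine exists_continuousOn_eqOn_exp_comp hsc ho hF ?_
  rintro ⟨z, hz, hz0⟩
  exact h0 z hz hz0

lemma eq_of_exp_eq_const {h : ℝ → ℂ} (hc : Continuous h) (he : ∀ t, exp (h t) = exp (h 0))
    (t : ℝ) : h t = h 0 := by
  have := isCoveringMap_exp.eq_of_comp_eq (g₁ := h) (g₂ := fun _ => h 0) hc continuous_const
    (funext fun t => Subtype.ext (he t)) 0 rfl
  exact congrFun this t

variable {X : Type*} [TopologicalSpace X]

/-- The nonvanishing functions that have a continuous logarithm. -/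
noncomputable def expSubgroup (X : Type*) [TopologicalSpace X] : Subgroup C(X, ℂˣ) where
  carrier := {u | ∃ g : C(X, ℂ), ∀ x, (u x : ℂ) = exp (g x)}
  mul_mem' := by
    rintro u v ⟨g, hg⟩ ⟨h, hh⟩
    exact ⟨g + h, fun x => by simp [hg, hh, exp_add]⟩
  one_mem' := ⟨0, fun x => by simp⟩
  inv_mem' := by
    rintro u ⟨g, hg⟩
    exact ⟨-g, fun x => by simp [hg, exp_neg]⟩

/-- Nonvanishing functions modulo those with a continuous logarithm, written additively. -/
def LogClass (X : Type*) [TopologicalSpace X] : Type _ :=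
  Additive (C(X, ℂˣ) ⧸ expSubgroup X)

noncomputable instance : AddCommGroup (LogClass X) :=
  Additive.addCommGroup (α := C(X, ℂˣ) ⧸ expSubgroup X)

/-- The class of a nonvanishing function. -/
noncomputable def logClass (u : C(X, ℂˣ)) : LogClass X :=
  Additive.ofMul (QuotientGroup.mk u)

lemma logClass_mul (u v : C(X, ℂˣ)) : logClass (u * v) = logClass u + logClass v := rfl

lemma logClass_zpow (u : C(X, ℂˣ)) (n : ℤ) : logClass (u ^ n) = n • logClass u := rfl

lemma logClass_pow (u : C(X, ℂˣ)) (n : ℕ) : logClass (u ^ n) = n • logClass u := rfl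

lemma logClass_prod {ι : Type*} (s : Finset ι) (u : ι → C(X, ℂˣ)) :
    logClass (∏ i ∈ s, u i) = ∑ i ∈ s, logClass (u i) := by
  classical
  induction s using Finset.induction_on with
  | empty => rfl
  | insert a s ha ih => rw [Finset.prod_insert ha, Finset.sum_insert ha, logClass_mul, ih]

lemma logClass_eq_iff {u v : C(X, ℂˣ)} :
    logClass u = logClass v ↔ ∃ g : C(X, ℂ), ∀ x, (v x : ℂ) = u x * exp (g x) := by
  have h : logClass u = logClass v ↔ u⁻¹ * v ∈ expSubgroup X :=
    Additive.ofMul.injective.eq_iff.trans QuotientGroup.eq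
  rw [h]
  refine exists_congr fun g => forall_congr' fun x => ?_
  simp only [ContinuousMap.mul_apply, ContinuousMap.inv_apply, Units.val_mul,
    Units.val_inv_eq_inv_val]
  rw [inv_mul_eq_iff_eq_mul₀ (u x).ne_zero]

lemma logClass_eq_zero_iff {u : C(X, ℂˣ)} :
    logClass u = 0 ↔ ∃ g : C(X, ℂ), ∀ x, (u x : ℂ) = exp (g x) := by
  rw [eq_comm, show (0 : LogClass X) = logClass 1 from rfl, logClass_eq_iff]
  simp

lemma logClass_eq_of_norm_sub_lt {u v : C(X, ℂˣ)}
    (h : ∀ x, ‖(v x : ℂ) - u x‖ < ‖(u x : ℂ)‖) : logClass u = logClass v := by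
  have hslit : ∀ x, (v x : ℂ) / u x ∈ slitPlane := by
    intro x
    have h1 : (v x : ℂ) / u x = 1 + ((v x : ℂ) - u x) / u x := by
      field_simp
      ring
    rw [h1]
    apply mem_slitPlane_of_norm_lt_one
    rw [norm_div, div_lt_one (norm_pos_iff.2 (u x).ne_zero)]
    exact h x
  have hcont : Continuous fun x => log ((v x : ℂ) / u x) :=
    ((Units.continuous_val.comp v.continuous).div (Units.continuous_val.comp u.continuous)
      fun x => (u x).ne_zero).clog hslit
  refine logClass_eq_iff.2 ⟨⟨_, hcont⟩, fun x => ?_⟩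
  have hx := exp_log (slitPlane_ne_zero (hslit x))
  change (v x : ℂ) = u x * exp (log (v x / u x))
  rw [hx]
  field_simp

/-- A continuous nonvanishing complex function as a map into the units. -/
noncomputable def unitsMap (F : X → ℂ) (hF : Continuous F) (h0 : ∀ x, F x ≠ 0) : C(X, ℂˣ) where
  toFun x := Units.mk0 (F x) (h0 x)
  continuous_toFun := Units.continuous_iff.2 ⟨hF, by
    simp only [Units.val_inv_eq_inv_val, Units.val_mk0]
    exact hF.inv₀ h0⟩

@[simp]
lemma unitsMap_apply (F : X → ℂ) (hF : Continuous F) (h0 : ∀ x, F x ≠ 0) (x : X) :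
    (unitsMap F hF h0 x : ℂ) = F x := rfl

/-- The nonvanishing function `f - a`. -/
noncomputable def linFactor (f : C(X, ℂ)) (a : ℂ) (ha : a ∉ range f) : C(X, ℂˣ) :=
  unitsMap (fun x => f x - a) (f.continuous.sub continuous_const)
    fun x hx => ha ⟨x, sub_eq_zero.1 hx⟩

@[simp]
lemma linFactor_apply (f : C(X, ℂ)) (a : ℂ) (ha : a ∉ range f) (x : X) :
    (linFactor f a ha x : ℂ) = f x - a := rfl

/-- The nonzero classes of the functions `f - a`. -/
def linClasses (f : C(X, ℂ)) : Set (LogClass X) :=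
  {κ | κ ≠ 0 ∧ ∃ a, ∃ ha : a ∉ range f, logClass (linFactor f a ha) = κ}

lemma logClass_linFactor_eq_zero {f : C(X, ℂ)} {a : ℂ} (ha : a ∉ range f)
    (h : ∀ x, ‖f x‖ < ‖a‖) : logClass (linFactor f a ha) = 0 := by
  rcases isEmpty_or_nonempty X with hX | ⟨⟨x₀⟩⟩
  · exact logClass_eq_zero_iff.2 ⟨0, fun x => (hX.false x).elim⟩
  have ha0 : -a ≠ 0 := neg_ne_zero.2 (norm_pos_iff.1 ((norm_nonneg _).trans_lt (h x₀)))
  rw [← logClass_eq_of_norm_sub_lt (u := unitsMap (fun _ => -a) continuous_const fun _ => ha0)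
    (by simpa using h)]
  exact logClass_eq_zero_iff.2 ⟨.const X (log (-a)), fun x => by simp [exp_log ha0]⟩

lemma exists_ball_logClass_eq [CompactSpace X] {f : C(X, ℂ)} {a : ℂ} (ha : a ∉ range f) :
    ∃ δ > 0, ∀ b ∈ Metric.ball a δ, ∃ hb : b ∉ range f,
      logClass (linFactor f b hb) = logClass (linFactor f a ha) := by
  have hopen : IsOpen (range f)ᶜ := (isCompact_range f.continuous).isClosed.isOpen_compl
  obtain ⟨δ, hδ, hsub⟩ := Metric.isOpen_iff.1 hopen a ha
  refine ⟨δ, hδ, fun b hb => ⟨hsub hb, (logClass_eq_of_norm_sub_lt fun x => ?_).symm⟩⟩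
  have hx : δ ≤ ‖f x - a‖ := by
    by_contra! hlt
    exact hsub (by simpa [dist_eq] using hlt : f x ∈ Metric.ball a δ) ⟨x, rfl⟩
  have hba : ‖a - b‖ < δ := by
    rw [norm_sub_rev]
    simpa [dist_eq] using hb
  simpa using hba.trans_le hx

/-- If a power of `f - c` agrees up to an exponential with a function that extends without zeros
over the closure of the set of all `a` with `f - a` equivalent to `f - c`, then the exponent
vanishes. -/
lemma exponent_eq_zero_of_extension [CompactSpace X] {f : C(X, ℂ)} (hf : IsClosedEmbedding f)
    {c : ℂ} (hc : c ∉ range f) (hne : logClass (linFactor f c hc) ≠ 0) {N : ℤ} {v : C(X, ℂˣ)}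
    (hv : N • logClass (linFactor f c hc) = logClass v) {V : ℂ → ℂ} (hVv : ∀ x, V (f x) = v x)
    (hV : ∀ z, (z ∈ range f ∨ ∃ hz : z ∉ range f,
      logClass (linFactor f z hz) = logClass (linFactor f c hc)) → ContinuousAt V z ∧ V z ≠ 0) :
    N = 0 := by
  classical
  set A : Set ℂ := {a | ∃ ha : a ∉ range f,
    logClass (linFactor f a ha) = logClass (linFactor f c hc)} with hA
  have hcA : c ∈ A := ⟨hc, rfl⟩
  have hAo : IsOpen A := by
    rw [Metric.isOpen_iff]
    rintro a ⟨ha, hac⟩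
    obtain ⟨δ, hδ, hball⟩ := exists_ball_logClass_eq ha
    exact ⟨δ, hδ, fun b hb => (hball b hb).imp fun hb' h => h.trans hac⟩
  have hAc : ∀ z ∈ closure A, z ∈ range f ∨ z ∈ A := by
    intro z hz
    by_contra! hcon
    obtain ⟨δ, hδ, hball⟩ := exists_ball_logClass_eq hcon.1
    obtain ⟨b, ⟨hb, hbc⟩, hzb⟩ := Metric.mem_closure_iff.1 hz δ hδ
    obtain ⟨hb', h⟩ := hball b (by rwa [Metric.mem_ball, dist_comm])
    exact hcon.2 ⟨hcon.1, h.symm.trans hbc⟩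
  obtain ⟨M, hM⟩ := (isCompact_range f.continuous).isBounded.exists_norm_le
  have hAM : ∀ a ∈ A, ‖a‖ ≤ M := by
    rintro a ⟨ha, hac⟩
    by_contra! hlt
    exact hne (hac.symm.trans (logClass_linFactor_eq_zero ha
      fun x => (hM _ ⟨x, rfl⟩).trans_lt hlt))
  rw [← logClass_zpow, logClass_eq_iff] at hv
  obtain ⟨g, hg⟩ := hv
  obtain ⟨G, hG⟩ := ContinuousMap.exists_extension hf g
  have hGf : ∀ x, G (f x) = g x := fun x => DFunLike.congr_fun hG x
  let W : ℂ → ℂ := A.piecewise (fun z => V z * exp (-G z)) (fun z => (z - c) ^ N)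
  have hWc : Continuous W := by
    refine continuous_piecewise ?_ ?_ ?_
    · intro z hz
      rcases hAc z hz.1 with ⟨x, rfl⟩ | hzA
      · rw [hVv, hg, hGf, mul_assoc, ← exp_add]
        simp
      · exact absurd (hAo.interior_eq.symm ▸ hzA) hz.2
    · intro z hz
      refine ((hV z (hAc z hz)).1.mul ?_).continuousWithinAt
      exact (continuous_exp.comp G.continuous.neg).continuousAt
    · rw [hAo.isClosed_compl.closure_eq]
      intro z hz
      refine (ContinuousAt.zpow₀ (by fun_prop) N (Or.inl ?_)).continuousWithinAt
      rw [sub_ne_zero]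
      rintro rfl
      exact hz hcA
  have hW0 : ∀ z ∈ univ, W z ≠ 0 := by
    intro z _
    by_cases hz : z ∈ A
    · simp only [W, piecewise_eq_of_mem _ _ _ hz]
      exact mul_ne_zero (hV z (Or.inr hz)).2 (exp_ne_zero _)
    · simp only [W, piecewise_eq_of_notMem _ _ _ hz]
      refine zpow_ne_zero _ (sub_ne_zero.2 ?_)
      rintro rfl
      exact hz hcA
  obtain ⟨L, hLc, hL⟩ := exists_continuousOn_exp_eq convex_univ univ_nonempty isOpen_univ
    hWc.continuousOn hW0
  rw [continuousOn_univ] at hLc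
  set ρ : ℝ := |M| + ‖c‖ + 1
  have hρ : 0 < ρ := by positivity
  have hout : ∀ θ : ℝ, c + ρ * exp (θ * I) ∉ A := by
    intro θ hθ
    have h1 := hAM _ hθ
    have h2 : ‖(ρ : ℂ) * exp (θ * I)‖ = ρ := by
      rw [norm_mul, norm_exp_ofReal_mul_I, norm_real, Real.norm_of_nonneg hρ.le, mul_one]
    have h3 := norm_sub_le (c + ρ * exp (θ * I)) c
    rw [add_sub_cancel_left, h2] at h3
    have h4 := le_abs_self M
    simp only [ρ] at h3
    linarith
  have hWout : ∀ θ : ℝ, exp (L (c + ρ * exp (θ * I)) - N * (θ * I)) = (ρ : ℂ) ^ N := by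
    intro θ
    rw [exp_sub, hL _ (mem_univ _)]
    simp only [W, piecewise_eq_of_notMem _ _ _ (hout θ)]
    rw [add_sub_cancel_left, mul_zpow, exp_int_mul]
    exact mul_div_cancel_right₀ _ (zpow_ne_zero _ (exp_ne_zero _))
  have hconst := eq_of_exp_eq_const (h := fun θ : ℝ => L (c + ρ * exp (θ * I)) - N * (θ * I))
    (by fun_prop) (fun t => by simp only [hWout]) (2 * Real.pi)
  have hper : exp (((2 * Real.pi : ℝ) : ℂ) * I) = 1 := by
    push_cast
    exact exp_two_pi_mul_I
  simp only [hper, ofReal_zero, zero_mul, exp_zero, mul_zero] at hconst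
  have hz : (N : ℂ) * (((2 * Real.pi : ℝ) : ℂ) * I) = 0 := by linear_combination -hconst
  have hpi : ((2 * Real.pi : ℝ) : ℂ) * I ≠ 0 :=
    mul_ne_zero (ofReal_ne_zero.2 (by positivity)) I_ne_zero
  exact_mod_cast (mul_eq_zero.1 hz).resolve_right hpi

lemma linearIndependent_linClasses [CompactSpace X] {f : C(X, ℂ)} (hf : IsClosedEmbedding f) :
    LinearIndependent ℤ (Subtype.val : linClasses f → LogClass X) := by
  classical
  rw [linearIndependent_iff']
  intro s g hsum κ hκ
  choose a ha hclass using fun κ : linClasses f => κ.2.2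
  have hv : g κ • logClass (linFactor f (a κ) (ha κ)) =
      logClass (∏ i ∈ s.erase κ, linFactor f (a i) (ha i) ^ (-g i)) := by
    rw [logClass_prod, ← sub_eq_zero, ← hsum, ← Finset.add_sum_erase s _ hκ]
    simp only [logClass_zpow, hclass, neg_smul, Finset.sum_neg_distrib, sub_neg_eq_add]
  refine exponent_eq_zero_of_extension hf (ha κ) (by rw [hclass]; exact κ.2.1) hv
    (V := fun z => ∏ i ∈ s.erase κ, (z - a i) ^ (-g i)) (fun x => ?_) (fun z hz => ?_)
  · simp [ContinuousMap.prod_apply, Units.coe_prod]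
  · have hne : ∀ i ∈ s.erase κ, z - a i ≠ 0 := by
      intro i hi h
      rw [sub_eq_zero] at h
      subst h
      rcases hz with hz | ⟨hz, heq⟩
      · exact ha i hz
      · rw [hclass, hclass] at heq
        exact Finset.ne_of_mem_erase hi (Subtype.ext heq)
    refine ⟨?_, Finset.prod_ne_zero_iff.2 fun i hi => zpow_ne_zero _ (hne i hi)⟩
    refine tendsto_finsetProd _ fun i hi => ?_
    exact ContinuousAt.zpow₀ (by fun_prop) _ (Or.inl (hne i hi))

/-- Near `a`, the function `F` is `(z - a) ^ n` times an exponential. -/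
def HasLocalDegree (F : ℂ → ℂ) (a : ℂ) : Prop :=
  ∃ n : ℤ, ∃ h : ℂ → ℂ, ∀ᶠ z in 𝓝[≠] a, ContinuousAt h z ∧ F z = (z - a) ^ n * exp (h z)

lemma HasLocalDegree.eventually_ne {F : ℂ → ℂ} {a : ℂ} (h : HasLocalDegree F a) :
    ∀ᶠ z in 𝓝[≠] a, F z ≠ 0 := by
  obtain ⟨n, h, hh⟩ := h
  filter_upwards [hh, self_mem_nhdsWithin] with z hz hza
  rw [hz.2]
  exact mul_ne_zero (zpow_ne_zero _ (sub_ne_zero.2 hza)) (exp_ne_zero _)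

lemma HasLocalDegree.congr {F G : ℂ → ℂ} {a : ℂ} (h : HasLocalDegree F a)
    (hFG : G =ᶠ[𝓝 a] F) : HasLocalDegree G a := by
  obtain ⟨n, h, hh⟩ := h
  refine ⟨n, h, ?_⟩
  filter_upwards [hh, hFG.filter_mono nhdsWithin_le_nhds] with z hz hGz
  exact ⟨hz.1, hGz.trans hz.2⟩

lemma HasLocalDegree.mul_zpow {F : ℂ → ℂ} {a b : ℂ} (h : HasLocalDegree F b) (hab : b ≠ a)
    (m : ℤ) : HasLocalDegree (fun z => F z * (z - a) ^ m) b := by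
  obtain ⟨n, h, hh⟩ := h
  have hpos : 0 < dist b a := dist_pos.2 hab
  have hne : ∀ z ∈ Metric.ball b (dist b a), z - a ≠ 0 := by
    intro z hz hza
    rw [sub_eq_zero] at hza
    subst hza
    rw [Metric.mem_ball, dist_comm] at hz
    exact lt_irrefl _ hz
  obtain ⟨L, hLc, hL⟩ := exists_continuousOn_exp_eq (convex_ball b (dist b a))
    ⟨b, Metric.mem_ball_self hpos⟩ Metric.isOpen_ball (F := fun z => (z - a) ^ m)
    (fun z hz => (ContinuousAt.zpow₀ (f := fun z => z - a) (by fun_prop) m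
      (Or.inl (hne z hz))).continuousWithinAt)
    (fun z hz => zpow_ne_zero _ (hne z hz))
  refine ⟨n, fun z => h z + L z, ?_⟩
  filter_upwards [hh, nhdsWithin_le_nhds (Metric.ball_mem_nhds b hpos)] with z hz hzb
  refine ⟨hz.1.add (hLc.continuousAt (Metric.isOpen_ball.mem_nhds hzb)), ?_⟩
  rw [exp_add, hL z hzb, hz.2, mul_assoc]

/-- A zero of a real-differentiable function with invertible derivative has a local degree. -/
lemma hasLocalDegree_of_det_ne_zero {F : ℂ → ℂ} {a : ℂ} {A : ℂ →L[ℝ] ℂ} (hc : Continuous F)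
    (hF : HasFDerivAt F A a) (h0 : F a = 0) (hdet : A.det ≠ 0) : HasLocalDegree F a := by
  set α : ℂ := (A 1 - I * A I) / 2
  set β : ℂ := (A 1 + I * A I) / 2
  have hA : ∀ v, A v = α * v + β * (starRingEnd ℂ) v := by
    intro v
    have hv : A v = v.re * A 1 + v.im * A I := by
      conv_lhs => rw [show v = v.re • (1 : ℂ) + v.im • I by
        simp only [real_smul, mul_one]; exact (re_add_im v).symm]
      rw [map_add, map_smul, map_smul, real_smul, real_smul]
    have h1 : v + (starRingEnd ℂ) v = 2 * v.re := by rw [add_conj]; push_cast; rfl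
    have h2 : v - (starRingEnd ℂ) v = 2 * v.im * I := by rw [sub_conj]; push_cast; rfl
    rw [hv]
    simp only [α, β]
    linear_combination (-A 1 / 2) * h1 + (I * A I / 2) * h2 + (v.im * A I) * I_sq
  have hinj : ∀ v, A v = 0 → v = 0 := by
    intro v hv
    have hu : IsUnit (LinearMap.det (A : ℂ →ₗ[ℝ] ℂ)) := isUnit_iff_ne_zero.2 hdet
    have hk : LinearMap.ker (A : ℂ →ₗ[ℝ] ℂ) = ⊥ := LinearMap.isUnit_iff_ker_eq_bot _ |>.1
      (LinearMap.isUnit_iff_isUnit_det _ |>.2 hu)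
    exact LinearMap.ker_eq_bot'.1 hk v hv
  have hαβ : ‖α‖ ≠ ‖β‖ := by
    intro heq
    obtain ⟨v, hv⟩ := IsAlgClosed.exists_pow_nat_eq (-β * (starRingEnd ℂ) α) two_pos
    by_cases hα : α = 0
    · have hβ : β = 0 := by rwa [hα, norm_zero, eq_comm, norm_eq_zero] at heq
      exact one_ne_zero (hinj 1 (by rw [hA, hα, hβ]; simp))
    · have hnv : ‖v‖ ^ 2 = ‖α‖ ^ 2 := by
        rw [← norm_pow, hv, norm_mul, norm_neg, RCLike.norm_conj, ← heq, sq]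
      have hv0 : v ≠ 0 := by
        rintro rfl
        rw [norm_zero, eq_comm] at hnv
        exact hα (by simpa using hnv)
      refine hv0 (hinj v ?_)
      have h1 : v * (starRingEnd ℂ) v = α * (starRingEnd ℂ) α := by
        rw [mul_conj', mul_conj']
        exact_mod_cast hnv
      rw [hA]
      apply mul_left_cancel₀ hv0
      linear_combination α * hv + β * h1
  have hlittle := hF.isLittleO
  have hslit : ∀ (γ δ : ℂ) (φ : ℂ → ℂ), (∀ z, ‖φ z‖ = ‖z‖) → ‖δ‖ < ‖γ‖ →
      (∀ v, ‖A v - γ * φ v‖ ≤ ‖δ‖ * ‖v‖) →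
      ∀ᶠ z in 𝓝[≠] a, F z / (γ * φ (z - a)) ∈ slitPlane := by
    intro γ δ φ hφ hlt hAφ
    have hev := hlittle.def (c := (‖γ‖ - ‖δ‖) / 2) (by linarith)
    filter_upwards [nhdsWithin_le_nhds hev, self_mem_nhdsWithin] with z hz hza
    rw [h0, sub_zero] at hz
    have hpos : 0 < ‖z - a‖ := norm_pos_iff.2 (sub_ne_zero.2 hza)
    have hγ : 0 < ‖γ‖ := (norm_nonneg δ).trans_lt hlt
    have hden : 0 < ‖γ * φ (z - a)‖ := by
      rw [norm_mul, hφ]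
      positivity
    have h1 : F z / (γ * φ (z - a)) = 1 + (F z - γ * φ (z - a)) / (γ * φ (z - a)) := by
      rw [sub_div, div_self (norm_pos_iff.1 hden)]
      ring
    rw [h1]
    apply mem_slitPlane_of_norm_lt_one
    rw [norm_div, div_lt_one hden, norm_mul, hφ]
    calc ‖F z - γ * φ (z - a)‖
        = ‖(F z - A (z - a)) + (A (z - a) - γ * φ (z - a))‖ := by congr 1; ring
      _ ≤ (‖γ‖ - ‖δ‖) / 2 * ‖z - a‖ + ‖δ‖ * ‖z - a‖ :=
          (norm_add_le _ _).trans (add_le_add hz (hAφ _))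
      _ < ‖γ‖ * ‖z - a‖ := by nlinarith
  rcases hαβ.lt_or_gt with hlt | hlt
  · have hβ : β ≠ 0 := norm_pos_iff.1 ((norm_nonneg _).trans_lt hlt)
    have hs := hslit β α (starRingEnd ℂ) (fun z => RCLike.norm_conj z) hlt
      (fun v => by rw [hA]; simp)
    refine ⟨-1, fun z => log (F z / (β * (starRingEnd ℂ) (z - a))) + log β +
      ((Real.log (‖z - a‖ ^ 2) : ℝ) : ℂ), ?_⟩
    filter_upwards [hs, self_mem_nhdsWithin] with z hz hza
    have hza' : z - a ≠ 0 := sub_ne_zero.2 hza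
    have hcz : (starRingEnd ℂ) (z - a) ≠ 0 := (map_ne_zero _).2 hza'
    have hsq : ‖z - a‖ ^ 2 ≠ 0 := pow_ne_zero _ (norm_ne_zero_iff.2 hza')
    constructor
    · refine ((ContinuousAt.clog (f := fun z => F z / (β * (starRingEnd ℂ) (z - a))) ?_ hz).add
        continuousAt_const).add ?_
      · refine hc.continuousAt.div ?_ (mul_ne_zero hβ hcz)
        exact continuousAt_const.mul (continuous_conj.continuousAt.comp (by fun_prop))
      · refine continuous_ofReal.continuousAt.comp (ContinuousAt.log (by fun_prop) hsq)
    · rw [exp_add, exp_add, exp_log (slitPlane_ne_zero hz), exp_log hβ, ← ofReal_exp,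
        Real.exp_log (by positivity), zpow_neg_one]
      have := mul_conj' (z - a)
      push_cast
      rw [← this]
      field_simp
  · have hα : α ≠ 0 := norm_pos_iff.1 ((norm_nonneg _).trans_lt hlt)
    have hs := hslit α β id (fun z => rfl) hlt (fun v => by rw [hA]; simp)
    simp only [id] at hs
    refine ⟨1, fun z => log (F z / (α * (z - a))) + log α, ?_⟩
    filter_upwards [hs, self_mem_nhdsWithin] with z hz hza
    have hza' : z - a ≠ 0 := sub_ne_zero.2 hza
    constructor
    · refine (ContinuousAt.clog (f := fun z => F z / (α * (z - a))) ?_ hz).add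
        continuousAt_const
      exact hc.continuousAt.div (by fun_prop) (mul_ne_zero hα hza')
    · rw [exp_add, exp_log (slitPlane_ne_zero hz), exp_log hα, zpow_one]
      field_simp

lemma logClass_linFactor_mem_span (f : C(X, ℂ)) {a : ℂ} (ha : a ∉ range f) :
    logClass (linFactor f a ha) ∈ Submodule.span ℤ (linClasses f) := by
  by_cases h : logClass (linFactor f a ha) = 0
  · rw [h]
    exact zero_mem _
  · exact Submodule.subset_span ⟨h, a, ha, rfl⟩

lemma logClass_mem_span_of_finite_zeros [CompactSpace X] (f : C(X, ℂ)) {R : ℝ}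
    (hR : ∀ x, ‖f x‖ < R) (s : Finset ℂ) : ∀ {F : ℂ → ℂ}, Continuous F →
      (∀ z ∈ Metric.ball 0 R, F z = 0 → z ∈ s) → (∀ a ∈ s, HasLocalDegree F a) →
      (∀ a ∈ s, a ∉ range f) → ∀ u : C(X, ℂˣ), (∀ x, (u x : ℂ) = F (f x)) →
      logClass u ∈ Submodule.span ℤ (linClasses f) := by
  classical
  induction s using Finset.induction_on with
  | empty =>
    intro F hF hzero _ _ u hu
    have hzero' : logClass u = 0 := by
      rcases isEmpty_or_nonempty X with hX | ⟨⟨x₀⟩⟩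
      · exact logClass_eq_zero_iff.2 ⟨0, fun x => (hX.false x).elim⟩
      have hball : ∀ x, f x ∈ Metric.ball (0 : ℂ) R := fun x => by simpa using hR x
      obtain ⟨L, hLc, hL⟩ := exists_continuousOn_exp_eq (convex_ball (0 : ℂ) R)
        ⟨f x₀, hball x₀⟩ Metric.isOpen_ball hF.continuousOn
        (fun z hz h => Finset.notMem_empty _ (hzero z hz h))
      exact logClass_eq_zero_iff.2 ⟨⟨fun x => L (f x), hLc.comp_continuous f.continuous hball⟩,
        fun x => (hu x).trans (hL _ (hball x)).symm⟩
    rw [hzero']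
    exact zero_mem _
  | insert a s has ih =>
    intro F hF hzero hdeg hrange u hu
    obtain ⟨n, h, hh⟩ := hdeg a (Finset.mem_insert_self a s)
    have ha := hrange a (Finset.mem_insert_self a s)
    have hev : ∀ᶠ z in 𝓝 a, (z ∉ range f ∧ z ∉ (s : Set ℂ)) ∧
        (z ∈ ({a}ᶜ : Set ℂ) → ContinuousAt h z ∧ F z = (z - a) ^ n * exp (h z)) := by
      filter_upwards [(isCompact_range f.continuous).isClosed.isOpen_compl.mem_nhds ha,
        s.finite_toSet.isClosed.isOpen_compl.mem_nhds has, eventually_nhdsWithin_iff.1 hh]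
        with z h1 h2 h3
      exact ⟨⟨h1, h2⟩, h3⟩
    obtain ⟨ε, hε, hball⟩ := Metric.eventually_nhds_iff_ball.1 hev
    set r := ε / 2
    have hr : 0 < r := half_pos hε
    have hcl : ∀ z ∈ Metric.closedBall a r, z ∈ Metric.ball a ε := fun z hz =>
      Metric.closedBall_subset_ball (half_lt_self hε) hz
    have hsph : ∀ z ∈ Metric.sphere a r, ContinuousAt h z ∧ F z = (z - a) ^ n * exp (h z) := by
      intro z hz
      refine (hball z (hcl z (Metric.sphere_subset_closedBall hz))).2 ?_
      rintro rfl
      simp [hr.ne] at hz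
    obtain ⟨H, hH⟩ := ContinuousMap.exists_restrict_eq (Metric.isClosed_sphere (x := a) (ε := r))
      ⟨fun z => h z, continuousOn_iff_continuous_domRestrict.1
        fun z hz => (hsph z hz).1.continuousWithinAt⟩
    have hHh : ∀ z ∈ Metric.sphere a r, H z = h z := fun z hz => DFunLike.congr_fun hH ⟨z, hz⟩
    let F' : ℂ → ℂ := (Metric.closedBall a r).piecewise (fun z => exp (H z))
      (fun z => F z * (z - a) ^ (-n))
    have hF'out : ∀ z ∉ Metric.closedBall a r, F' z = F z * (z - a) ^ (-n) := fun z hz =>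
      piecewise_eq_of_notMem _ _ _ hz
    have hF'c : Continuous F' := by
      refine continuous_piecewise ?_ ?_ ?_
      · intro z hz
        rw [frontier_closedBall a hr.ne'] at hz
        have hza : z - a ≠ 0 := by
          rw [sub_ne_zero]
          rintro rfl
          simp [hr.ne] at hz
        rw [hHh z hz, (hsph z hz).2, zpow_neg]
        field_simp
      · exact (continuous_exp.comp H.continuous).continuousOn
      · rw [closure_compl, interior_closedBall a hr.ne']
        intro z hz
        refine (hF.continuousAt.mul
          (ContinuousAt.zpow₀ (by fun_prop) _ (Or.inl ?_))).continuousWithinAt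
        rw [sub_ne_zero]
        rintro rfl
        exact hz (Metric.mem_ball_self hr)
    have hfa : ∀ x, f x ∉ Metric.closedBall a r := fun x hx => (hball _ (hcl _ hx)).1.1 ⟨x, rfl⟩
    have hmem := ih (F := F') hF'c
      (by
        intro z hz hFz
        by_cases hza : z ∈ Metric.closedBall a r
        · simp only [F', piecewise_eq_of_mem _ _ _ hza] at hFz
          exact absurd hFz (exp_ne_zero _)
        · have hne : z ≠ a := by
            rintro rfl
            exact hza (Metric.mem_closedBall_self hr.le)
          rw [hF'out z hza] at hFz
          exact Finset.mem_of_mem_insert_of_ne (hzero z hz ((mul_eq_zero.1 hFz).resolve_right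
            (zpow_ne_zero _ (sub_ne_zero.2 hne)))) hne)
      (by
        intro b hb
        have hba : b ≠ a := fun h => has (h ▸ hb)
        have hbr : b ∉ Metric.closedBall a r := fun h => (hball _ (hcl _ h)).1.2 hb
        refine ((hdeg b (Finset.mem_insert_of_mem hb)).mul_zpow hba (-n)).congr ?_
        filter_upwards [Metric.isClosed_closedBall.isOpen_compl.mem_nhds hbr] with z hz
        exact hF'out z hz)
      (fun b hb => hrange b (Finset.mem_insert_of_mem hb))
      (u * linFactor f a ha ^ (-n))
      (fun x => by rw [hF'out _ (hfa x)]; simp [hu])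
    rw [logClass_mul, logClass_zpow] at hmem
    have hsum := add_mem hmem (Submodule.smul_mem _ n (logClass_linFactor_mem_span f ha))
    rwa [neg_smul, neg_add_cancel_right] at hsum

/-- Smooth functions approximate continuous ones uniformly on compact sets. -/
lemma exists_contDiff_norm_sub_lt (U : C(ℂ, ℂ)) {K : Set ℂ} (hK : IsCompact K) {ε : ℝ}
    (hε : 0 < ε) : ∃ q : ℂ → ℂ, ContDiff ℝ 1 q ∧ ∀ z ∈ K, ‖q z - U z‖ < ε := by
  have hd := ContinuousMap.dense_setOfPred_contDiff (E := ℂ) (F := ℂ) U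
  rw [mem_closure_iff_nhds_basis
    (nhds_basis_uniformity Metric.uniformity_basis_dist.compactConvergenceUniformity)] at hd
  obtain ⟨q, hq, hqU⟩ := hd (i := (K, ε)) ⟨hK, hε⟩
  have hq' : ContDiff ℝ (⊤ : ℕ∞) q := hq
  refine ⟨q, hq'.of_le (by exact_mod_cast le_top), fun z hz => ?_⟩
  rw [← dist_eq]
  exact hqU z hz

/-- Small regular values exist. -/
lemma exists_norm_lt_regular_value {q : ℂ → ℂ} (hq : ContDiff ℝ 1 q) {ε : ℝ} (hε : 0 < ε) :
    ∃ w : ℂ, ‖w‖ < ε ∧ ∀ z, q z = w → (fderiv ℝ q z).det ≠ 0 := by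
  have hnull : MeasureTheory.volume (q '' {z | (fderiv ℝ q z).det = 0}) = 0 :=
    MeasureTheory.addHaar_image_eq_zero_of_det_fderivWithin_eq_zero MeasureTheory.volume
      (fun z _ => ((hq.differentiable one_ne_zero) z).hasFDerivAt.hasFDerivWithinAt)
      (fun z hz => hz)
  by_contra! hcon
  have hsub : Metric.ball (0 : ℂ) ε ⊆ q '' {z | (fderiv ℝ q z).det = 0} := by
    intro w hw
    obtain ⟨z, hz, hdet⟩ := hcon w (by simpa using hw)
    exact ⟨z, hdet, hz⟩
  exact (Metric.measure_ball_pos MeasureTheory.volume (0 : ℂ) hε).ne'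
    (MeasureTheory.measure_mono_null hsub hnull)

/-- Up to an exponential, every nonvanishing function on a plane compactum is a product of integer
powers of functions `f - a`. -/
lemma logClass_mem_span [CompactSpace X] {f : C(X, ℂ)} (hf : IsClosedEmbedding f)
    (u : C(X, ℂˣ)) : logClass u ∈ Submodule.span ℤ (linClasses f) := by
  have huc : Continuous fun x => (u x : ℂ) := Units.continuous_val.comp u.continuous
  obtain ⟨δ, hδ, hδu⟩ : ∃ δ > 0, ∀ x, δ ≤ ‖(u x : ℂ)‖ := by
    obtain ⟨C, hC0, hC⟩ := (isCompact_range
      (huc.inv₀ fun x => (u x).ne_zero)).isBounded.exists_pos_norm_le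
    refine ⟨C⁻¹, inv_pos.2 hC0, fun x => ?_⟩
    have := hC _ ⟨x, rfl⟩
    rw [Pi.inv_apply, norm_inv] at this
    exact inv_le_of_inv_le₀ (norm_pos_iff.2 (u x).ne_zero) this
  obtain ⟨U, hU⟩ := ContinuousMap.exists_extension hf ⟨fun x => (u x : ℂ), huc⟩
  have hUf : ∀ x, U (f x) = u x := fun x => DFunLike.congr_fun hU x
  obtain ⟨q, hq, hqU⟩ := exists_contDiff_norm_sub_lt U (isCompact_range f.continuous)
    (half_pos hδ)
  obtain ⟨w, hw, hreg⟩ := exists_norm_lt_regular_value hq (half_pos hδ)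
  obtain ⟨M, hM⟩ := (isCompact_range f.continuous).isBounded.exists_norm_le
  have hFc : Continuous fun z => q z - w := hq.continuous.sub continuous_const
  have hclose : ∀ x, ‖q (f x) - w - u x‖ < ‖(u x : ℂ)‖ := by
    intro x
    have h1 := hqU _ ⟨x, rfl⟩
    rw [hUf] at h1
    calc ‖q (f x) - w - u x‖ = ‖(q (f x) - u x) - w‖ := by congr 1; ring
      _ ≤ ‖q (f x) - u x‖ + ‖w‖ := norm_sub_le _ _
      _ < δ := by linarith
      _ ≤ _ := hδu x
  have hne : ∀ x, q (f x) - w ≠ 0 := by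
    intro x hx
    have := hclose x
    rw [hx, zero_sub, norm_neg] at this
    exact lt_irrefl _ this
  have hdeg : ∀ z, q z - w = 0 → HasLocalDegree (fun z => q z - w) z := fun z hz =>
    hasLocalDegree_of_det_ne_zero hFc
      (((hq.differentiable one_ne_zero) z).hasFDerivAt.sub_const w) hz
      (hreg z (sub_eq_zero.1 hz))
  set Z : Set ℂ := {z | q z - w = 0} ∩ Metric.closedBall 0 (M + 1)
  have hZ : Z.Finite := by
    by_contra hinf
    obtain ⟨z, -, hz⟩ := Set.Infinite.exists_accPt_of_subset_isCompact hinf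
      (isCompact_closedBall (0 : ℂ) (M + 1)) inter_subset_right
    have hfreq := accPt_iff_frequently_nhdsNE.1 hz
    have hz0 : q z - w = 0 :=
      (isClosed_singleton.preimage hFc).closure_subset_iff.2 (fun y hy => hy.1 : Z ⊆ _)
        hz.clusterPt.mem_closure
    exact hfreq ((hdeg z hz0).eventually_ne.mono fun y hy hyZ => hy hyZ.1)
  rw [logClass_eq_of_norm_sub_lt (u := u) (v := unitsMap _ (hFc.comp f.continuous) hne) hclose]
  refine logClass_mem_span_of_finite_zeros f (R := M + 1)
    (fun x => (hM _ ⟨x, rfl⟩).trans_lt (lt_add_one M)) hZ.toFinset hFc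
    (fun z hz h0 => hZ.mem_toFinset.2 ⟨h0, Metric.ball_subset_closedBall hz⟩)
    (fun a ha => hdeg a (hZ.mem_toFinset.1 ha).1) ?_ _ (fun x => rfl)
  rintro a ha ⟨x, rfl⟩
  exact hne x (hZ.mem_toFinset.1 ha).1

/-- On a plane compactum, a nonvanishing function with roots of order `3 ^ m` for all `m` has a
continuous logarithm. -/
lemma logClass_eq_zero_of_divisible [CompactSpace X] {f : C(X, ℂ)} (hf : IsClosedEmbedding f)
    {u : C(X, ℂˣ)} (hu : ∀ m : ℕ, ∃ v : C(X, ℂˣ), v ^ 3 ^ m = u) : logClass u = 0 := by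
  have hli := linearIndependent_linClasses hf
  have hspan : ∀ v : C(X, ℂˣ), logClass v ∈
      Submodule.span ℤ (range (Subtype.val : linClasses f → LogClass X)) := fun v => by
    rw [Subtype.range_coe]
    exact logClass_mem_span hf v
  have hrepr : hli.repr ⟨logClass u, hspan u⟩ = 0 := by
    ext κ
    obtain ⟨m, hm⟩ : ∃ m : ℕ, (hli.repr ⟨logClass u, hspan u⟩ κ).natAbs < 3 ^ m :=
      ⟨_, Nat.lt_pow_self (by norm_num)⟩
    obtain ⟨v, hv⟩ := hu m
    have huv : (⟨logClass u, hspan u⟩ : Submodule.span ℤ (range (Subtype.val :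
        linClasses f → LogClass X))) = 3 ^ m • ⟨logClass v, hspan v⟩ :=
      Subtype.ext ((congrArg logClass hv.symm).trans (logClass_pow v _))
    have hdvd : (3 ^ m : ℤ) ∣ hli.repr ⟨logClass u, hspan u⟩ κ := by
      rw [huv, map_nsmul]
      exact ⟨hli.repr ⟨logClass v, hspan v⟩ κ, by simp⟩
    rw [Finsupp.zero_apply]
    refine Int.eq_zero_of_abs_lt_dvd hdvd ?_
    rw [Int.abs_eq_natAbs]
    exact_mod_cast hm
  have h0 := hli.linearCombination_repr ⟨logClass u, hspan u⟩
  rw [hrepr, map_zero] at h0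
  exact h0.symm

end PlanarCompacta

/-! ### The solenoid is not planar -/

namespace Solenoid3

open Topology

instance : CompactSpace Solenoid3 := by
  refine isCompact_iff_compactSpace.1 (IsClosed.isCompact ?_)
  have hset : {x : ℕ → Circle | ∀ i, x (i + 1) ^ 3 = x i} =
      ⋂ i, {x | x (i + 1) ^ 3 = x i} := by
    ext x
    simp
  refine (congrArg IsClosed hset).mpr ?_
  exact isClosed_iInter fun i =>
    isClosed_eq ((continuous_apply (i + 1)).pow 3) (continuous_apply i)

/-- The `n`-th coordinate as a nonvanishing function. -/
noncomputable def coordUnits (n : ℕ) : C(Solenoid3, ℂˣ) :=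
  unitsMap (fun x => (x.1 n : ℂ)) (continuous_subtype_val.comp (continuous_coord n))
    fun _ => Circle.coe_ne_zero _

lemma coordUnits_pow (n : ℕ) : coordUnits n ^ 3 ^ n = coordUnits 0 := by
  have hcoord : ∀ x : Solenoid3, x.1 n ^ 3 ^ n = x.1 0 := by
    intro x
    induction n with
    | zero => simp
    | succ n ih => rw [pow_succ', pow_mul, x.2, ih]
  ext x
  have := congrArg (fun c : Circle => (c : ℂ)) (hcoord x)
  simpa [coordUnits] using this

/-- A dense one-parameter subgroup of the solenoid. -/
noncomputable def line (t : ℝ) : Solenoid3 :=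
  ⟨fun n => Circle.exp (t / 3 ^ n), fun n => by
    rw [← Circle.exp_nsmul]
    congr 1
    rw [pow_succ, nsmul_eq_mul]
    push_cast
    field_simp⟩

lemma continuous_line : Continuous line :=
  Continuous.subtype_mk (continuous_pi fun n => by fun_prop) _

lemma logClass_coordUnits_ne_zero : logClass (coordUnits 0) ≠ 0 := by
  intro h
  obtain ⟨g, hg⟩ := logClass_eq_zero_iff.1 h
  have hexp : ∀ t : ℝ, Complex.exp (g (line t) - t * Complex.I) = 1 := by
    intro t
    rw [Complex.exp_sub, ← hg]
    simp [coordUnits, line]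
  have hconst := eq_of_exp_eq_const (h := fun t : ℝ => g (line t) - t * Complex.I)
    ((g.continuous.comp continuous_line).sub (by fun_prop)) (fun t => by simp only [hexp])
  obtain ⟨M, hM⟩ := (isCompact_range g.continuous).isBounded.exists_norm_le
  have h1 := hconst (2 * M + 1)
  have hM0 : 0 ≤ M := (norm_nonneg _).trans (hM _ ⟨line 0, rfl⟩)
  have h2 : ((2 * M + 1 : ℝ) : ℂ) * Complex.I = g (line (2 * M + 1)) - g (line 0) := by
    simp only [Complex.ofReal_zero, zero_mul, sub_zero] at h1
    linear_combination -h1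
  have h3 := congrArg norm h2
  rw [norm_mul, Complex.norm_I, mul_one, Complex.norm_real,
    Real.norm_of_nonneg (by linarith)] at h3
  have h4 := norm_sub_le (g (line (2 * M + 1))) (g (line 0))
  have h5 := hM _ ⟨line (2 * M + 1), rfl⟩
  have h6 := hM _ ⟨line 0, rfl⟩
  linarith

theorem not_exists_isEmbedding : ¬∃ f : Solenoid3 → ℝ × ℝ, IsEmbedding f := by
  rintro ⟨f, hf⟩
  let e := Complex.equivRealProdCLM.symm.toHomeomorph
  have hemb : IsEmbedding (e ∘ f) := e.isEmbedding.comp hf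
  have hclosed : IsClosedEmbedding (⟨e ∘ f, hemb.continuous⟩ : C(Solenoid3, ℂ)) :=
    ⟨hemb, (isCompact_range hemb.continuous).isClosed⟩
  exact logClass_coordUnits_ne_zero
    (logClass_eq_zero_of_divisible hclosed fun m => ⟨coordUnits m, coordUnits_pow m⟩)

end Solenoid3

theorem solenoid_nonplanar_with_equivariant_map :
    (¬∃ f : Solenoid3 → ℝ × ℝ, Topology.IsEmbedding f) ∧
    (∃ Φ : Solenoid3DeletedSquare → Circle,
      Continuous Φ ∧
      ∀ (x y : Solenoid3) (h : x ≠ y),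
        (Φ ⟨(y, x), Ne.symm h⟩ : ℂ) = -(Φ ⟨(x, y), h⟩ : ℂ)) :=
  ⟨Solenoid3.not_exists_isEmbedding, Solenoid3.exists_equivariant_map⟩
end
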